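/- The cell class G_ξ is concentrated: there exist natural numbers q and r such that every permutation in G_ξ is (q,r)-concentrated. -/

import Mathlib

open Filter

/-- A permutation of some finite length `n`. -/
abbrev Permu : Type := Σ n : ℕ, Equiv.Perm (Fin n)

/-- `PLe σ π` : the permutation `σ` is contained in `π` as a pattern. -/
def PLe (σ π : Permu) : Prop :=
  ∃ f : Fin σ.1 → Fin π.1, StrictMono f ∧
    ∀ i j : Fin σ.1, σ.2 i < σ.2 j ↔ π.2 (f i) < π.2 (f j)

/-- A permutation class: a set of permutations closed downward under containment. -/
def IsPermClass (C : Set Permu) : Prop :=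
  ∀ σ π : Permu, PLe σ π → π ∈ C → σ ∈ C

/-- The number of permutations of length `n` in `C`. -/
noncomputable def pcount (C : Set Permu) (n : ℕ) : ℕ :=
  Set.ncard {π ∈ C | π.1 = n}

/-- The upper growth rate of a class, as an extended real. -/
noncomputable def ugr (C : Set Permu) : EReal :=
  limsup (fun n : ℕ => (((pcount C n : ℝ) ^ ((n : ℝ)⁻¹) : ℝ) : EReal)) atTop

/-- The lower growth rate of a class, as an extended real. -/
noncomputable def lgr (C : Set Permu) : EReal :=
  liminf (fun n : ℕ => (((pcount C n : ℝ) ^ ((n : ℝ)⁻¹) : ℝ) : EReal)) atTop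
/-- The direct sum of two permutations, on underlying finite types. -/
def permSum {m n : ℕ} (π : Equiv.Perm (Fin m)) (σ : Equiv.Perm (Fin n)) :
    Equiv.Perm (Fin (m + n)) :=
  finSumFinEquiv.symm.trans ((Equiv.sumCongr π σ).trans finSumFinEquiv)

/-- The sum `π ⊕ σ` of two permutations. -/
def psum (π σ : Permu) : Permu := ⟨π.1 + σ.1, permSum π.2 σ.2⟩

/-- The skew sum of two permutations, on underlying finite types. -/
def permSkew {m n : ℕ} (π : Equiv.Perm (Fin m)) (σ : Equiv.Perm (Fin n)) :
    Equiv.Perm (Fin (m + n)) :=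
  finSumFinEquiv.symm.trans ((Equiv.sumCongr π σ).trans
    (((Equiv.sumComm (Fin m) (Fin n)).trans finSumFinEquiv).trans (finCongr (Nat.add_comm n m))))

/-- The skew sum `π ⊖ σ` of two permutations. -/
def pskew (π σ : Permu) : Permu := ⟨π.1 + σ.1, permSkew π.2 σ.2⟩

/-- A set of permutations is sum closed if it is closed under `⊕`. -/
def SumClosed (C : Set Permu) : Prop := ∀ π σ : Permu, π ∈ C → σ ∈ C → psum π σ ∈ C

/-- A set of permutations is skew closed if it is closed under `⊖`. -/
def SkewClosed (C : Set Permu) : Prop := ∀ π σ : Permu, π ∈ C → σ ∈ C → pskew π σ ∈ C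

/-- A permutation is sum indecomposable if it is not the sum of two nonempty permutations. -/
def SumIndec (τ : Permu) : Prop := ¬ ∃ π σ : Permu, 0 < π.1 ∧ 0 < σ.1 ∧ τ = psum π σ

/-- A permutation is skew indecomposable if it is not the skew sum of two nonempty
permutations. -/
def SkewIndec (τ : Permu) : Prop := ¬ ∃ π σ : Permu, 0 < π.1 ∧ 0 < σ.1 ∧ τ = pskew π σ

/-- `Sub π` : the class of all permutations contained in `π`. -/
def SubCl (π : Permu) : Set Permu := {σ | PLe σ π}

/-- The sum closure of a set of permutations: the smallest sum closed class containing it. -/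
def sumClosure (C : Set Permu) : Set Permu :=
  ⋂₀ {D : Set Permu | IsPermClass D ∧ SumClosed D ∧ C ⊆ D}

/-- The skew closure of a set of permutations: the smallest skew closed class containing it. -/
def skewClosure (C : Set Permu) : Set Permu :=
  ⋂₀ {D : Set Permu | IsPermClass D ∧ SkewClosed D ∧ C ⊆ D}

/-- The cell class `G_γ`: permutations `π` with `gr(⊕Sub(π)) < γ` or `gr(⊖Sub(π)) < γ`.
(These growth rates exist, so they coincide with the upper growth rates used here.) -/
noncomputable def cellClass (γ : ℝ) : Set Permu :=
  {π | ugr (sumClosure (SubCl π)) < (γ : EReal) ∨ ugr (skewClosure (SubCl π)) < (γ : EReal)}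
/-- An axis-parallel rectangle `[a,b] × [c,d]` with integer (1-based) coordinates. -/
structure Rect where
  a : ℕ
  b : ℕ
  c : ℕ
  d : ℕ
deriving DecidableEq

/-- The rectangle `R` covers the point `(x+1, π(x)+1)` of the plot of `π`. -/
def rectCovers (R : Rect) (π : Permu) (x : Fin π.1) : Prop :=
  R.a ≤ (x : ℕ) + 1 ∧ (x : ℕ) + 1 ≤ R.b ∧
    R.c ≤ (π.2 x : ℕ) + 1 ∧ (π.2 x : ℕ) + 1 ≤ R.d

/-- The rectangle `R` avoids the line `x = c + 1/2` (if `vert`) or `y = c + 1/2`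
(otherwise). -/
def rectAvoids (R : Rect) (vert : Bool) (c : ℕ) : Prop :=
  if vert then R.b ≤ c ∨ c + 1 ≤ R.a else R.d ≤ c ∨ c + 1 ≤ R.c

/-- Two rectangles are independent: their index intervals are disjoint and their value
intervals are disjoint. -/
def rectIndep (R S : Rect) : Prop :=
  (R.b < S.a ∨ S.b < R.a) ∧ (R.d < S.c ∨ S.d < R.c)

/-- A permutation `π` is `(q,r)`-concentrated: for every horizontal or vertical line
through its plot, all but at most `r` of the points of the plot can be covered by at
most `q` pairwise independent axis-parallel rectangles, each avoiding the line. -/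
def ConcentratedQR (q r : ℕ) (π : Permu) : Prop :=
  ∀ (vert : Bool) (c : ℕ), c ≤ π.1 →
    ∃ Rs : Finset Rect, Rs.card ≤ q ∧
      (∀ R ∈ Rs, rectAvoids R vert c) ∧
      (∀ R ∈ Rs, ∀ S ∈ Rs, R ≠ S → rectIndep R S) ∧
      {x : Fin π.1 | ¬ ∃ R ∈ Rs, rectCovers R π x}.ncard ≤ r

namespace CC

/-- one-line notation (0-based) -/
def word (σ : Permu) : List ℕ := List.ofFn fun i => (σ.2 i : ℕ)

lemma word_length (σ : Permu) : (word σ).length = σ.1 := by simp [word]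

lemma word_inj {σ τ : Permu} (h : word σ = word τ) : σ = τ := by
  obtain ⟨n, σ⟩ := σ
  obtain ⟨m, τ⟩ := τ
  have hl : n = m := by
    have := congrArg List.length h
    simpa [word] using this
  subst hl
  have h2 := List.ofFn_injective h
  congr 1
  ext i
  exact congrFun h2 i

lemma permSum_left {m n : ℕ} (π : Equiv.Perm (Fin m)) (σ : Equiv.Perm (Fin n)) (i : Fin m) :
    permSum π σ (Fin.castAdd n i) = Fin.castAdd n (π i) := by
  simp [permSum]

lemma permSum_right {m n : ℕ} (π : Equiv.Perm (Fin m)) (σ : Equiv.Perm (Fin n)) (i : Fin n) :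
    permSum π σ (Fin.natAdd m i) = Fin.natAdd m (σ i) := by
  simp [permSum]

lemma word_psum (σ ρ : Permu) :
    word (psum σ ρ) = word σ ++ (word ρ).map (fun v => σ.1 + v) := by
  apply List.ext_getElem
  · simp [word, psum]
  · intro i h1 h2
    have hlt : i < σ.1 + ρ.1 := by simpa [word, psum] using h1
    simp only [word, psum, List.getElem_ofFn]
    by_cases hi : i < σ.1
    · rw [List.getElem_append_left (by simpa using hi), List.getElem_ofFn]
      exact congrArg Fin.val (permSum_left σ.2 ρ.2 ⟨i, hi⟩)
    · rw [List.getElem_append_right (by simpa using hi)]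
      have : (⟨i, hlt⟩ : Fin (σ.1 + ρ.1)) =
        Fin.natAdd σ.1 ⟨i - σ.1, by omega⟩ := by
          ext; simp; omega
      have h3 : ((permSum σ.2 ρ.2 ⟨i, hlt⟩ : Fin (σ.1 + ρ.1)) : ℕ) =
          σ.1 + (ρ.2 ⟨i - σ.1, by omega⟩ : ℕ) := by
        rw [this, permSum_right]
        simp
      refine Eq.trans h3 ?_
      simp

/-- indecomposability of a word -/
def Indec (S : List ℕ) : Prop := ∀ m, 0 < m → m < S.length → ∃ v ∈ S.take m, m ≤ v

lemma word_lt (σ : Permu) : ∀ v ∈ word σ, v < σ.1 := by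
  intro v hv
  simp only [word, List.mem_ofFn] at hv
  obtain ⟨i, rfl⟩ := hv
  exact (σ.2 i).2

lemma psum_aux {σ σ' ρ ρ' : Permu} (h : psum σ ρ = psum σ' ρ') (h1 : 0 < σ.1)
    (hi' : Indec (word σ')) : σ'.1 ≤ σ.1 := by
  by_contra hlt
  push Not at hlt
  obtain ⟨v, hv, hle⟩ := hi' σ.1 h1 (by simpa [word_length] using hlt)
  have hw := congrArg word h
  rw [word_psum, word_psum] at hw
  have ht := congrArg (List.take σ.1) hw
  rw [List.take_append_of_le_length (by simp [word_length]),
    List.take_append_of_le_length (by simp [word_length]; omega)] at ht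
  rw [← ht] at hv
  have := word_lt σ v (List.mem_of_mem_take hv)
  omega

lemma psum_inj {σ σ' ρ ρ' : Permu} (h : psum σ ρ = psum σ' ρ') (h1 : 0 < σ.1) (h1' : 0 < σ'.1)
    (hi : Indec (word σ)) (hi' : Indec (word σ')) : σ = σ' ∧ ρ = ρ' := by
  have hl : σ.1 = σ'.1 := le_antisymm (psum_aux h.symm h1' hi) (psum_aux h h1 hi')
  have hw := congrArg word h
  rw [word_psum, word_psum] at hw
  obtain ⟨ha, hb⟩ := List.append_inj hw (by simp [word_length, hl])
  have := word_inj ha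
  subst this
  refine ⟨rfl, word_inj ?_⟩
  exact List.map_injective_iff.2 (fun a b hab => by simpa using hab) hb

lemma fin_len (n : ℕ) : {π : Permu | π.1 = n}.Finite := by
  have : {π : Permu | π.1 = n} = Set.range (fun σ : Equiv.Perm (Fin n) => (⟨n, σ⟩ : Permu)) := by
    ext ⟨m, σ⟩
    constructor
    · rintro rfl
      exact ⟨σ, rfl⟩
    · rintro ⟨τ, h⟩
      exact (congrArg Sigma.fst h).symm
  rw [this]
  exact Set.finite_range _

lemma fin_cl (C : Set Permu) (n : ℕ) : {π ∈ C | π.1 = n}.Finite :=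
  (fin_len n).subset fun _ h => h.2

def wt (S : List ℕ) : ℕ := 2306 ^ (5 - S.length) * 1000 ^ S.length
def wsum (P : List (List ℕ)) : ℕ := (P.map wt).sum

lemma psum_mem {A : Set Permu} {σ ρ : Permu} (h : σ ∈ sumClosure A) (h' : ρ ∈ sumClosure A) :
    psum σ ρ ∈ sumClosure A := by
  intro D hD
  exact hD.2.1 _ _ (h D hD) (h' D hD)

lemma sub_mem {A : Set Permu} {σ : Permu} (h : σ ∈ A) : σ ∈ sumClosure A :=
  fun _ hD => hD.2.2 h

lemma count_rec (C : Set Permu) (hC : ∀ σ ρ, σ ∈ C → ρ ∈ C → psum σ ρ ∈ C)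
    (F : Finset (List ℕ)) (g : List ℕ → Permu) (hg : ∀ S ∈ F, word (g S) = S ∧ g S ∈ C ∧
      Indec S ∧ 1 ≤ S.length ∧ S.length ≤ 5) (n : ℕ) (hn : 5 ≤ n) :
    ∑ S ∈ F, pcount C (n - S.length) ≤ pcount C n := by
  classical
  unfold pcount
  simp_rw [Set.ncard_eq_toFinset_card _ (fin_cl C _)]
  rw [← Finset.card_sigma]
  apply Finset.card_le_card_of_injOn (fun p => psum (g p.1) p.2)
  · rintro ⟨S, ρ⟩ h
    simp only [Finset.coe_sigma, Set.mem_sigma_iff, Finset.mem_coe, Set.Finite.mem_toFinset,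
      Set.mem_ofPred_eq] at h ⊢
    obtain ⟨hS, hρ, hl⟩ := h
    obtain ⟨h1, h2, h3, h4, h5⟩ := hg S hS
    refine ⟨hC _ _ h2 hρ, ?_⟩
    have := word_length (g S)
    rw [h1] at this
    simp only [psum]
    omega
  · rintro ⟨S, ρ⟩ h ⟨S', ρ'⟩ h' heq
    simp only [Finset.coe_sigma, Set.mem_sigma_iff, Finset.mem_coe, Set.Finite.mem_toFinset,
      Set.mem_ofPred_eq] at h h' heq
    obtain ⟨h1, h2, h3, h4, h5⟩ := hg S h.1
    obtain ⟨h1', h2', h3', h4', h5'⟩ := hg S' h'.1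
    have l1 := word_length (g S)
    have l1' := word_length (g S')
    rw [h1] at l1
    rw [h1'] at l1'
    obtain ⟨ha, hb⟩ := psum_inj heq (by omega) (by omega) (by rwa [h1]) (by rwa [h1'])
    have : S = S' := by rw [← h1, ← h1', ha]
    subst this
    subst hb
    rfl

lemma xi_le (ξ : ℝ) (hroot : ξ ^ 5 - 2 * ξ ^ 4 - ξ ^ 2 - ξ - 1 = 0) : ξ ≤ 2.306 := by
  by_contra h
  push Not at h
  have h0 : ξ ^ 2 * (ξ - 2) > 1.627 := by nlinarith
  have h1 : ξ ^ 2 * (ξ ^ 2 * (ξ - 2) - 1) > ξ ^ 2 * 0.627 :=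
    mul_lt_mul_of_pos_left (by linarith) (by positivity)
  nlinarith

lemma good_contra (π : Permu) (ξ : ℝ) (hpos : 0 < ξ)
    (hroot : ξ ^ 5 - 2 * ξ ^ 4 - ξ ^ 2 - ξ - 1 = 0) (P : List (List ℕ)) (hnd : P.Nodup)
    (hP : ∀ S ∈ P, (∃ σ : Permu, word σ = S ∧ PLe σ π) ∧ Indec S ∧ 1 ≤ S.length ∧ S.length ≤ 5)
    (hw : 2306 ^ 5 ≤ wsum P) : ¬ ugr (sumClosure (SubCl π)) < (ξ : EReal) := by
  classical
  intro hlt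
  set C := sumClosure (SubCl π) with hCdef
  have h1xi : 1 ≤ ξ := by
    by_contra h
    push Not at h
    have : ξ ^ 5 ≤ ξ ^ 4 := pow_le_pow_of_le_one hpos.le h.le (by norm_num)
    nlinarith [pow_pos hpos 4, pow_pos hpos 2]
  have hxl := xi_le ξ hroot
  have : ∀ S, ∃ σ : Permu, S ∈ P → word σ = S ∧ σ ∈ C ∧ Indec S ∧ 1 ≤ S.length ∧ S.length ≤ 5 := by
    intro S
    by_cases hS : S ∈ P
    · obtain ⟨⟨σ, h1, h2⟩, h3, h4⟩ := hP S hS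
      exact ⟨σ, fun _ => ⟨h1, sub_mem h2, h3, h4⟩⟩
    · exact ⟨⟨0, 1⟩, fun h => absurd h hS⟩
  choose g hg using this
  have hrec := count_rec C (fun _ _ => psum_mem) P.toFinset g (fun S hS => hg S (by simpa using hS))
  -- nonempty
  have hne : P ≠ [] := by
    rintro rfl
    simp [wsum] at hw
  obtain ⟨S0, hS0⟩ := List.exists_mem_of_ne_nil P hne
  obtain ⟨⟨σ0, h1, f0, -⟩, -, h2, -⟩ := hP S0 hS0
  have hπ : 0 < π.1 := by
    have : 0 < σ0.1 := by rw [← word_length, h1]; omega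
    exact lt_of_le_of_lt (Nat.zero_le _) (f0 ⟨0, this⟩).2
  have hone : (⟨1, 1⟩ : Permu) ∈ C := by
    apply sub_mem
    refine ⟨fun _ => ⟨0, hπ⟩, ?_, ?_⟩
    · intro i j hij
      exact absurd hij (by simp [Subsingleton.elim i j])
    · intro i j
      simp [Subsingleton.elim i j]
  have hzero : (⟨0, 1⟩ : Permu) ∈ C := by
    apply sub_mem
    exact ⟨fun i => i.elim0, fun i => i.elim0, fun i => i.elim0⟩
  have hex : ∀ n, ∃ ρ ∈ C, ρ.1 = n := by
    intro n
    induction n with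
    | zero => exact ⟨_, hzero, rfl⟩
    | succ n ih =>
      obtain ⟨ρ, h, rfl⟩ := ih
      exact ⟨psum ρ ⟨1, 1⟩, psum_mem h hone, rfl⟩
  have hge1 : ∀ n, 1 ≤ pcount C n := by
    intro n
    obtain ⟨ρ, h, h'⟩ := hex n
    exact (Set.ncard_pos (fin_cl C n)).2 ⟨ρ, h, h'⟩
  -- weights
  have hwR : ξ ^ 5 ≤ ∑ S ∈ P.toFinset, ξ ^ (5 - S.length) := by
    have hw2 : (2306 : ℝ) ^ 5 ≤ ∑ S ∈ P.toFinset, (2306 : ℝ) ^ (5 - S.length) * 1000 ^ S.length := by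
      rw [List.sum_toFinset _ hnd]
      have : ((2306 ^ 5 : ℕ) : ℝ) ≤ (wsum P : ℕ) := by exact_mod_cast hw
      unfold wsum at this
      rw [Nat.cast_list_sum, List.map_map] at this
      have e : (Nat.cast ∘ wt : List ℕ → ℝ) =
          fun S => (2306 : ℝ) ^ (5 - S.length) * 1000 ^ S.length := by
        funext S
        simp [wt]
      rw [e] at this
      refine le_trans (le_of_eq (by norm_num)) this
    have hterm : ∀ S ∈ P.toFinset, (2306 : ℝ) ^ (5 - S.length) * 1000 ^ S.length * ξ ^ 5 ≤
        2306 ^ 5 * ξ ^ (5 - S.length) := by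
      intro S hS
      obtain ⟨-, -, -, h4, h5⟩ := hg S (by simpa using hS)
      have e : ξ ^ 5 = ξ ^ (5 - S.length) * ξ ^ S.length := by
        rw [← pow_add]; congr 1; omega
      have e' : (2306 : ℝ) ^ 5 = 2306 ^ (5 - S.length) * 2306 ^ S.length := by
        rw [← pow_add]; congr 1; omega
      rw [e, e']
      have : (1000 : ℝ) ^ S.length * ξ ^ S.length ≤ 2306 ^ S.length := by
        rw [← mul_pow]
        apply pow_le_pow_left₀ (by positivity)
        linarith
      calc _ = (2306 : ℝ) ^ (5 - S.length) * ξ ^ (5 - S.length) *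
            (1000 ^ S.length * ξ ^ S.length) := by ring
        _ ≤ (2306 : ℝ) ^ (5 - S.length) * ξ ^ (5 - S.length) * 2306 ^ S.length :=
            mul_le_mul_of_nonneg_left this (by positivity)
        _ = _ := by ring
    have := Finset.sum_le_sum hterm
    rw [← Finset.sum_mul, ← Finset.mul_sum] at this
    have h3 : (2306 : ℝ) ^ 5 * ξ ^ 5 ≤ 2306 ^ 5 * ∑ S ∈ P.toFinset, ξ ^ (5 - S.length) :=
      le_trans (mul_le_mul_of_nonneg_right hw2 (by positivity)) this
    exact le_of_mul_le_mul_left h3 (by positivity)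
  have hgrow : ∀ n, ξ ^ n ≤ ξ ^ 5 * (pcount C n : ℝ) := by
    intro n
    induction n using Nat.strong_induction_on with
    | _ n ih =>
      by_cases hn : n < 5
      · have a1 : ξ ^ n ≤ ξ ^ 5 := pow_le_pow_right₀ h1xi hn.le
        have a2 : (1 : ℝ) ≤ pcount C n := by exact_mod_cast hge1 n
        nlinarith [pow_pos hpos 5]
      · push Not at hn
        have r1 : ((∑ S ∈ P.toFinset, pcount C (n - S.length) : ℕ) : ℝ) ≤ pcount C n := by
          exact_mod_cast hrec n hn
        push_cast at r1
        have e : ξ ^ n = ξ ^ (n - 5) * ξ ^ 5 := by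
          rw [← pow_add]; congr 1; omega
        calc ξ ^ n = ξ ^ (n - 5) * ξ ^ 5 := e
          _ ≤ ξ ^ (n - 5) * ∑ S ∈ P.toFinset, ξ ^ (5 - S.length) :=
            mul_le_mul_of_nonneg_left hwR (by positivity)
          _ = ∑ S ∈ P.toFinset, ξ ^ (n - S.length) := by
            rw [Finset.mul_sum]
            apply Finset.sum_congr rfl
            intro S hS
            obtain ⟨-, -, -, h4, h5⟩ := hg S (by simpa using hS)
            rw [← pow_add]; congr 1; omega
          _ ≤ ∑ S ∈ P.toFinset, ξ ^ 5 * (pcount C (n - S.length) : ℝ) := by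
            apply Finset.sum_le_sum
            intro S hS
            obtain ⟨-, -, -, h4, h5⟩ := hg S (by simpa using hS)
            exact ih _ (by omega)
          _ = ξ ^ 5 * ∑ S ∈ P.toFinset, (pcount C (n - S.length) : ℝ) := by rw [Finset.mul_sum]
          _ ≤ _ := mul_le_mul_of_nonneg_left r1 (by positivity)
  -- contradiction
  obtain ⟨y, hy1, hy2⟩ := EReal.lt_iff_exists_real_btwn.1 hlt
  have hyξ : y < ξ := by exact_mod_cast hy2
  have hev := Filter.eventually_lt_of_limsup_lt hy1
  have hev2 : ∀ᶠ n : ℕ in atTop, ξ ^ n < ξ ^ 5 * y ^ n := by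
    filter_upwards [hev, eventually_gt_atTop 0] with n hn hn0
    have hn' : ((pcount C n : ℝ) ^ ((n : ℝ)⁻¹)) < y := by exact_mod_cast hn
    have hp : (pcount C n : ℝ) = ((pcount C n : ℝ) ^ ((n : ℝ)⁻¹)) ^ n := by
      rw [Real.rpow_inv_natCast_pow (by positivity) (by omega)]
    have : (pcount C n : ℝ) < y ^ n := by
      rw [hp]
      exact pow_lt_pow_left₀ hn' (by positivity) (by omega)
    exact lt_of_le_of_lt (hgrow n) (mul_lt_mul_of_pos_left this (by positivity))
  have hypos : 0 < y := by
    obtain ⟨n, hn⟩ := hev.exists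
    have hn' : ((pcount C n : ℝ) ^ ((n : ℝ)⁻¹)) < y := by exact_mod_cast hn
    exact lt_of_le_of_lt (by positivity) hn'
  have ht : Tendsto (fun n : ℕ => (ξ / y) ^ n) atTop atTop :=
    tendsto_pow_atTop_atTop_of_one_lt ((one_lt_div hypos).2 hyξ)
  obtain ⟨n, hn1, hn2⟩ := (hev2.and (ht.eventually_gt_atTop (ξ ^ 5))).exists
  rw [div_pow, lt_div_iff₀ (by positivity)] at hn2
  linarith

end CC

namespace CC

def subsAux {α : Type} (l : List α) : ℕ → List (List α) → List (List α) :=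
  List.rec (motive := fun _ => ℕ → List (List α) → List (List α))
    (fun k acc => Nat.casesOn k ([] :: acc) (fun _ => acc))
    (fun a _ ih k acc => Nat.casesOn k ([] :: acc) (fun k' =>
      List.rec (ih (k' + 1) acc) (fun x _ ih2 => (a :: x) :: ih2) (ih k' [])))
    l
def subs {α : Type} (k : ℕ) (l : List α) : List (List α) := subsAux l k []
def insX (a : ℕ × ℕ) (l : List (ℕ × ℕ)) : List (ℕ × ℕ) :=
  List.rec [a] (fun b l ih => bif Nat.ble a.1 b.1 then a :: b :: l else b :: ih) l
def sortX (l : List (ℕ × ℕ)) : List (ℕ × ℕ) :=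
  List.rec [] (fun a _ ih => insX a ih) l
def cntLt (a : ℕ) (l : List ℕ) : ℕ :=
  List.rec 0 (fun b _ ih => Bool.rec (Nat.succ ih) ih (Nat.ble a b)) l
def stdL (l : List ℕ) : List ℕ := l.map fun a => cntLt a l
def eqL (l : List ℕ) : List ℕ → Bool :=
  List.rec (motive := fun _ => List ℕ → Bool)
    (fun m => List.casesOn m true (fun _ _ => false))
    (fun a _ ih m => List.casesOn m false (fun b m' => Bool.rec false (ih m') (Nat.beq a b))) l
def memL (a : List ℕ) (ls : List (List ℕ)) : Bool :=
  List.rec false (fun b _ ih => Bool.rec ih true (eqL a b)) ls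
def runMax (a mx : ℕ) : ℕ := Bool.rec mx (a + 1) (Nat.ble mx a)
def indecRun (S : List ℕ) : ℕ → ℕ → Bool :=
  List.rec (motive := fun _ => ℕ → ℕ → Bool) (fun _ _ => true)
    (fun a _ ih m mx => Bool.rec (ih (m + 1) (runMax a mx))
      (Bool.rec false (ih (m + 1) (runMax a mx)) (Nat.beq m 0)) (Nat.ble mx m)) S
def indecB (S : List ℕ) : Bool := indecRun S 0 0
def forceN {β : Type} (n : ℕ) (k : ℕ → β) : β :=
  Nat.casesOn n (k 0) (fun m => k (m + 1))
def forceL {β : Type} (l : List ℕ) : (List ℕ → β) → β :=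
  List.rec (motive := fun _ => (List ℕ → β) → β) (fun k => k [])
    (fun a _ ih k => forceN a fun a' => ih fun l' => k (a' :: l')) l
def forceMap {β : Type} (g : ℕ → ℕ) (l : List ℕ) : (List ℕ → β) → β :=
  List.rec (motive := fun _ => (List ℕ → β) → β) (fun k => k [])
    (fun a _ ih k => forceN (g a) fun a' => ih fun l' => k (a' :: l')) l
def collect (ls : List (List ℕ)) : ℕ → List (List ℕ) → List (List ℕ) :=
  List.rec (motive := fun _ => ℕ → List (List ℕ) → List (List ℕ)) (fun _ acc => acc)
    (fun l _ ih w acc => forceL l fun l' => forceMap (fun a => cntLt a l') l' fun S =>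
      Bool.rec (Bool.rec (ih w acc) (forceN (w + wt S) fun w' =>
        Bool.rec (ih w' (S :: acc)) (S :: acc) (Nat.ble (2306 ^ 5) w')) (indecB S))
        (ih w acc) (memL S acc)) ls
def cands (ys : List ℕ) : List (List ℕ) :=
  subs 1 ys ++ (subs 2 ys ++ (subs 3 ys ++ (subs 4 ys ++ subs 5 ys)))
def pats (L : List (ℕ × ℕ)) : List (List ℕ) :=
  forceL ((sortX L).map Prod.snd) fun ys => collect (cands ys) 0 []
def wtOK (L : List (ℕ × ℕ)) : Bool :=
  Nat.ble (2306 ^ 5) (wsum (pats L)) &&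
    (decide (((sortX L).map Prod.fst).Pairwise (· < ·)) && decide ((sortX L).map Prod.snd).Nodup)

def ext (s : Bool) (t : ℕ) : ℕ := bif s then 100 + (8 * t + 4) else 100 - (8 * t + 4)
def mid (s : Bool) (t : ℕ) : ℕ := bif s then 100 + 8 * t else 100 - 8 * t
def cfg (s : Bool) : List (Bool × Bool) → List (ℕ × ℕ)
  | [] => [(ext s 1, 100)]
  | (d, s') :: w =>
    (ext s (w.length + 2), mid s' (w.length + 1)) ::
      (ext s (w.length + 2) + 1,
        bif d then mid s' (w.length + 1) + 1 else mid s' (w.length + 1) - 1) ::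
        (cfg s' w).map Prod.swap
def bools : List Bool := [true, false]
def pairsB : List (Bool × Bool) := [(true, true), (true, false), (false, true), (false, false)]
def tree4 : Bool :=
  bools.all fun s => pairsB.all fun a => pairsB.all fun b => pairsB.all fun c =>
    wtOK ((cfg s [a, b, c]).map Prod.swap) ||
      (bools.all fun s0 => bools.all fun d => wtOK (cfg s0 ((d, s) :: [a, b, c])))
def altC (s i j : Bool) : List (ℕ × ℕ) :=
  (List.range 5).map (fun k => ((bif s then 0 else 10) + (bif i then k else 5 - k), 2 * k)) ++
  (List.range 5).map (fun k => ((bif s then 10 else 0) + (bif j then k else 5 - k), 2 * k + 1))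
def altAll : Bool := bools.all fun s => bools.all fun i => bools.all fun j =>
  wtOK (altC s i j) && wtOK ((altC s i j).map Prod.swap)

set_option maxRecDepth 100000 in
theorem altAll_ok : altAll = true := by decide +kernel
set_option maxRecDepth 100000 in
theorem tree4_ok : tree4 = true := by decide +kernel

lemma forceN_eq {β : Type} (n : ℕ) (k : ℕ → β) : forceN n k = k n := by
  cases n <;> rfl

lemma forceMap_eq {β : Type} (g : ℕ → ℕ) (l : List ℕ) (k : List ℕ → β) :
    forceMap g l k = k (l.map g) := by
  induction l generalizing k with
  | nil => rfl
  | cons a l ih =>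
    change forceN (g a) (fun a' => forceMap g l fun l' => k (a' :: l')) = _
    rw [forceN_eq, ih]
    rfl

lemma forceL_eq {β : Type} (l : List ℕ) (k : List ℕ → β) : forceL l k = k l := by
  induction l generalizing k with
  | nil => rfl
  | cons a l ih =>
    change forceN a (fun a' => forceL l fun l' => k (a' :: l')) = _
    rw [forceN_eq, ih]

lemma subs_cons_aux {α : Type} (a : α) (M acc : List (List α)) :
    (List.rec acc (fun x _ ih2 => (a :: x) :: ih2) M : List (List α)) = M.map (a :: ·) ++ acc := by
  induction M with
  | nil => rfl
  | cons x M ih => simp [ih]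

lemma mem_subsAux {α : Type} (l : List α) (k : ℕ) (acc : List (List α)) (s : List α)
    (h : s ∈ subsAux l k acc) : s ∈ acc ∨ (s.Sublist l ∧ s.length = k) := by
  induction l generalizing k acc s with
  | nil =>
    cases k with
    | zero =>
      change s ∈ [] :: acc at h
      rcases List.mem_cons.1 h with rfl | h
      · exact Or.inr ⟨List.Sublist.refl _, rfl⟩
      · exact Or.inl h
    | succ k => exact Or.inl h
  | cons a l ih =>
    cases k with
    | zero =>
      change s ∈ [] :: acc at h
      rcases List.mem_cons.1 h with rfl | h
      · exact Or.inr ⟨List.nil_sublist _, rfl⟩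
      · exact Or.inl h
    | succ k =>
      change s ∈ (List.rec (subsAux l (k + 1) acc) (fun x _ ih2 => (a :: x) :: ih2)
        (subsAux l k []) : List (List α)) at h
      rw [subs_cons_aux] at h
      rcases List.mem_append.1 h with h | h
      · obtain ⟨x, hx, rfl⟩ := List.mem_map.1 h
        rcases ih _ _ _ hx with h | ⟨h1, h2⟩
        · simp at h
        · exact Or.inr ⟨h1.cons_cons a, by simp [h2]⟩
      · rcases ih _ _ _ h with h | ⟨h1, h2⟩
        · exact Or.inl h
        · exact Or.inr ⟨h1.cons a, h2⟩

lemma mem_subs {α : Type} {l : List α} {k : ℕ} {s : List α} (h : s ∈ subs k l) :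
    s.Sublist l ∧ s.length = k := by
  rcases mem_subsAux _ _ _ _ h with h | h
  · simp at h
  · exact h

lemma mem_insX (a p : ℕ × ℕ) (l : List (ℕ × ℕ)) (h : p ∈ insX a l) : p = a ∨ p ∈ l := by
  induction l with
  | nil => simpa [insX] using h
  | cons b l ih =>
    change p ∈ (bif Nat.ble a.1 b.1 then a :: b :: l else b :: insX a l) at h
    cases hb : Nat.ble a.1 b.1 <;> rw [hb] at h
    · simp only [cond_false, List.mem_cons] at h ⊢
      tauto
    · simpa using h

lemma mem_sortX (p : ℕ × ℕ) (l : List (ℕ × ℕ)) (h : p ∈ sortX l) : p ∈ l := by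
  induction l with
  | nil => simp [sortX] at h
  | cons b l ih =>
    rcases mem_insX b p (sortX l) h with h | h
    · simp [h]
    · simp [ih h]

lemma cntLt_cons (a b : ℕ) (l : List ℕ) :
    cntLt a (b :: l) = if b < a then cntLt a l + 1 else cntLt a l := by
  change (Bool.rec (Nat.succ (cntLt a l)) (cntLt a l) (Nat.ble a b) : ℕ) = _
  cases hb : Nat.ble a b
  · have : ¬ a ≤ b := fun h => by simp [Nat.ble_eq_true_of_le h] at hb
    rw [if_pos (by omega)]
  · have : a ≤ b := Nat.le_of_ble_eq_true hb
    rw [if_neg (by omega)]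

lemma cntLt_mono {a b : ℕ} (h : a ≤ b) (l : List ℕ) : cntLt a l ≤ cntLt b l := by
  induction l with
  | nil => exact le_refl _
  | cons c l ih => rw [cntLt_cons, cntLt_cons]; split_ifs <;> omega

lemma cntLt_strict {a b : ℕ} (h : a < b) (l : List ℕ) (ha : a ∈ l) : cntLt a l < cntLt b l := by
  induction l with
  | nil => simp at ha
  | cons c l ih =>
    rw [cntLt_cons, cntLt_cons]
    rcases List.mem_cons.1 ha with rfl | h'
    · have := cntLt_mono h.le l
      rw [if_neg (lt_irrefl _), if_pos h]
      omega
    · have := ih h'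
      split_ifs <;> omega

lemma cntLt_le (a : ℕ) (l : List ℕ) : cntLt a l ≤ l.length := by
  induction l with
  | nil => exact le_refl _
  | cons c l ih => rw [cntLt_cons]; simp only [List.length_cons]; split_ifs <;> omega

lemma cntLt_iff {a b : ℕ} {l : List ℕ} (ha : a ∈ l) :
    cntLt a l < cntLt b l ↔ a < b := by
  constructor
  · intro h
    by_contra h'
    have := cntLt_mono (not_lt.1 h') l
    omega
  · exact fun h => cntLt_strict h l ha

lemma cntLt_lt (a : ℕ) (l : List ℕ) (ha : a ∈ l) : cntLt a l < l.length :=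
  lt_of_lt_of_le (cntLt_strict (Nat.lt_succ_self a) l ha) (cntLt_le _ _)

lemma eqL_self (l : List ℕ) : eqL l l = true := by
  induction l with
  | nil => rfl
  | cons a l ih =>
    change (Bool.rec false (eqL l l) (Nat.beq a a) : Bool) = true
    rw [Nat.beq_refl]
    exact ih

lemma memL_of_mem (a : List ℕ) (ls : List (List ℕ)) (h : a ∈ ls) : memL a ls = true := by
  induction ls with
  | nil => simp at h
  | cons b ls ih =>
    change (Bool.rec (memL a ls) true (eqL a b) : Bool) = true
    rcases List.mem_cons.1 h with rfl | h
    · rw [eqL_self]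
    · rw [ih h]; cases eqL a b <;> rfl

lemma indecRun_spec (T : List ℕ) : ∀ (m mx : ℕ) (pre : List ℕ), pre.length = m →
    (mx = 0 ∨ ∃ v ∈ pre, v + 1 = mx) → indecRun T m mx = true →
    ∀ j < T.length, 0 < m + j → ∃ v ∈ (pre ++ T).take (m + j), m + j ≤ v := by
  induction T with
  | nil => intro m mx pre _ _ _ j hj; simp at hj
  | cons a T ih =>
    intro m mx pre hpre hmx h j hj hpos
    change (Bool.rec (indecRun T (m + 1) (runMax a mx))
      (Bool.rec false (indecRun T (m + 1) (runMax a mx)) (Nat.beq m 0)) (Nat.ble mx m) : Bool)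
      = true at h
    have hr : indecRun T (m + 1) (runMax a mx) = true := by
      cases h1 : Nat.ble mx m <;> rw [h1] at h
      · exact h
      · cases h2 : Nat.beq m 0 <;> rw [h2] at h
        · simp at h
        · exact h
    cases j with
    | zero =>
      have hmx2 : m < mx := by
        by_contra hle
        rw [Nat.ble_eq_true_of_le (not_lt.1 hle)] at h
        cases h2 : Nat.beq m 0 <;> rw [h2] at h
        · simp at h
        · have := Nat.eq_of_beq_eq_true h2
          omega
      rcases hmx with rfl | ⟨v, hv, rfl⟩
      · omega
      · refine ⟨v, ?_, by omega⟩
        rw [List.take_append_of_le_length (by omega), List.take_of_length_le (by omega)]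
        exact hv
    | succ j =>
      have hm : runMax a mx = 0 ∨ ∃ v ∈ pre ++ [a], v + 1 = runMax a mx := by
        unfold runMax
        cases Nat.ble mx a
        · rcases hmx with h | ⟨v, hv, h⟩
          · exact Or.inl h
          · exact Or.inr ⟨v, by simp [hv], h⟩
        · exact Or.inr ⟨a, by simp, rfl⟩
      have := ih (m + 1) _ (pre ++ [a]) (by simp [hpre]) hm hr j (by simpa using hj) (by omega)
      simpa [List.append_assoc, Nat.add_assoc, Nat.add_comm 1 j] using this

lemma indecB_spec {S : List ℕ} (h : indecB S = true) : Indec S := by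
  intro m hm hl
  have := indecRun_spec S 0 0 [] rfl (Or.inl rfl) h m hl (by omega)
  simpa using this

lemma collect_spec (Q : List ℕ → Prop) (ls : List (List ℕ)) :
    ∀ (w : ℕ) (acc : List (List ℕ)), acc.Nodup → (∀ S ∈ acc, Q S) →
    (∀ l ∈ ls, indecB (stdL l) = true → Q (stdL l)) →
    (collect ls w acc).Nodup ∧ ∀ S ∈ collect ls w acc, Q S := by
  induction ls with
  | nil => intro w acc h1 h2 _; exact ⟨h1, h2⟩
  | cons l ls ih =>
    intro w acc h1 h2 h3
    have e : collect (l :: ls) w acc = (forceL l fun l' => forceMap (fun a => cntLt a l') l' fun S =>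
      (Bool.rec (Bool.rec (collect ls w acc) (forceN (w + wt S) fun w' =>
        Bool.rec (collect ls w' (S :: acc)) (S :: acc) (Nat.ble (2306 ^ 5) w')) (indecB S))
        (collect ls w acc) (memL S acc) : List (List ℕ))) := rfl
    rw [e, forceL_eq, forceMap_eq, forceN_eq]
    have h3' : ∀ l ∈ ls, indecB (stdL l) = true → Q (stdL l) :=
      fun l' hl' => h3 l' (List.mem_cons_of_mem _ hl')
    have hs : l.map (fun a => cntLt a l) = stdL l := rfl
    rw [hs]
    cases hm : memL (stdL l) acc
    · cases hi : indecB (stdL l)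
      · exact ih _ _ h1 h2 h3'
      · have hq := h3 l (by simp) hi
        have n1 : (stdL l :: acc).Nodup := by
          refine List.nodup_cons.2 ⟨fun h => ?_, h1⟩
          rw [memL_of_mem _ _ h] at hm
          simp at hm
        have n2 : ∀ S ∈ stdL l :: acc, Q S := by
          intro S hS
          rcases List.mem_cons.1 hS with rfl | hS
          · exact hq
          · exact h2 S hS
        change List.Nodup (Bool.rec (collect ls (w + wt (stdL l)) (stdL l :: acc)) (stdL l :: acc)
          (Nat.ble (2306 ^ 5) (w + wt (stdL l)))) ∧ ∀ S ∈
          (Bool.rec (collect ls (w + wt (stdL l)) (stdL l :: acc)) (stdL l :: acc)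
          (Nat.ble (2306 ^ 5) (w + wt (stdL l))) : List (List ℕ)), Q S
        cases Nat.ble (2306 ^ 5) (w + wt (stdL l))
        · exact ih _ _ n1 n2 h3'
        · exact ⟨n1, n2⟩
    · exact ih _ _ h1 h2 h3'

lemma pats_spec (L : List (ℕ × ℕ)) : (pats L).Nodup ∧ ∀ S ∈ pats L, ∃ l : List ℕ,
    l.Sublist ((sortX L).map Prod.snd) ∧ S = stdL l ∧ Indec S ∧ 1 ≤ l.length ∧ l.length ≤ 5 := by
  unfold pats
  rw [forceL_eq]
  apply collect_spec
  · exact List.nodup_nil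
  · intro S hS; simp at hS
  · intro l hl hi
    have : l.Sublist ((sortX L).map Prod.snd) ∧ 1 ≤ l.length ∧ l.length ≤ 5 := by
      simp only [cands, List.mem_append] at hl
      rcases hl with h | h | h | h | h <;> obtain ⟨h1, h2⟩ := mem_subs h <;>
        exact ⟨h1, by omega, by omega⟩
    exact ⟨l, this.1, rfl, indecB_spec hi, this.2⟩

/-- realisation of a planar configuration -/
def Realz {V : Type} (co : Bool → V → ℕ) (b : Bool) (L : List (ℕ × ℕ)) : Prop :=
  ∃ F : ℕ × ℕ → V, ∀ p ∈ L, ∀ q ∈ L, (p.1 < q.1 → co b (F p) < co b (F q)) ∧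
    (p.2 < q.2 → co (!b) (F p) < co (!b) (F q))

def pco (π : Permu) (b : Bool) (x : Fin π.1) : ℕ := if b then (x : ℕ) else (π.2 x : ℕ)

lemma realz_pattern (π : Permu) (L : List (ℕ × ℕ)) (hR : Realz (pco π) true L)
    (hx : ((sortX L).map Prod.fst).Pairwise (· < ·)) (hy : ((sortX L).map Prod.snd).Nodup)
    (l : List ℕ) (hl : l.Sublist ((sortX L).map Prod.snd)) :
    ∃ σ : Permu, word σ = stdL l ∧ PLe σ π := by
  obtain ⟨F, hF⟩ := hR
  obtain ⟨sub, hsub, rfl⟩ := List.sublist_map_iff.1 hl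
  have hnd : (sub.map Prod.snd).Nodup := hy.sublist hl
  have hpw : (sub.map Prod.fst).Pairwise (· < ·) := hx.sublist (hsub.map _)
  have hmem : ∀ p ∈ sub, p ∈ L := fun p hp => mem_sortX p L (hsub.subset hp)
  set l := sub.map Prod.snd with hldef
  have hlen : l.length = sub.length := by simp [hldef]
  let g : Fin l.length → Fin l.length := fun i => ⟨cntLt l[i] l, cntLt_lt _ _ (List.getElem_mem _)⟩
  have key : ∀ i j : Fin l.length, g i < g j ↔ l[i] < l[j] := fun i j =>
    cntLt_iff (List.getElem_mem _)
  have hinj : Function.Injective g := by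
    intro i j hij
    have h1 := (key i j).not.1 (by rw [hij]; exact lt_irrefl _)
    have h2 := (key j i).not.1 (by rw [hij]; exact lt_irrefl _)
    have h3 : l[i] = l[j] := by omega
    exact Fin.ext ((List.Nodup.getElem_inj_iff hnd).1 h3)
  refine ⟨⟨l.length, Equiv.ofBijective g (Finite.injective_iff_bijective.1 hinj)⟩, ?_, ?_⟩
  · apply List.ext_getElem
    · simp [word, stdL]
    · intro i h1 h2
      simp [word, stdL, g]
  · have hF1 : ∀ i j : Fin l.length, i < j → F (sub[i]'(by have := i.2; omega)) <
        F (sub[j]'(by have := j.2; omega)) := by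
      intro i j hij
      have hi := i.2
      have hj := j.2
      have := (hF _ (hmem _ (List.getElem_mem (l := sub) (n := i) (by omega))) _
        (hmem _ (List.getElem_mem (l := sub) (n := j) (by omega)))).1 (by
          have := List.pairwise_iff_getElem.1 hpw i j (by simp; omega) (by simp; omega) hij
          simpa using this)
      simpa [pco] using this
    refine ⟨fun (i : Fin l.length) => F (sub[i]'(by have h : (i : ℕ) < l.length := i.2; omega)), fun i j hij => hF1 i j hij, ?_⟩
    have hv : ∀ i j : Fin l.length, l[i] < l[j] → π.2 (F (sub[i]'(by have := i.2; omega))) <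
        π.2 (F (sub[j]'(by have := j.2; omega))) := by
      intro i j hij
      have hi := i.2
      have hj := j.2
      have := (hF _ (hmem _ (List.getElem_mem (l := sub) (n := i) (by omega))) _
        (hmem _ (List.getElem_mem (l := sub) (n := j) (by omega)))).2 (by
          simpa [hldef] using hij)
      simpa [pco] using this
    intro i j
    change g i < g j ↔ _
    rw [key]
    constructor
    · exact hv i j
    · intro h
      by_contra h'
      rcases lt_or_eq_of_le (not_lt.1 h') with h2 | h2
      · exact lt_asymm h (hv j i h2)
      · have : i = j := Fin.ext ((List.Nodup.getElem_inj_iff hnd).1 h2.symm)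
        subst this
        exact lt_irrefl _ h

lemma no_realz (π : Permu) (ξ : ℝ) (hpos : 0 < ξ)
    (hroot : ξ ^ 5 - 2 * ξ ^ 4 - ξ ^ 2 - ξ - 1 = 0)
    (hgood : ugr (sumClosure (SubCl π)) < (ξ : EReal)) (L : List (ℕ × ℕ)) (hL : wtOK L = true) :
    ¬ Realz (pco π) true L := by
  intro hR
  unfold wtOK at hL
  simp only [Bool.and_eq_true, decide_eq_true_eq] at hL
  obtain ⟨h1, h2, h3⟩ := hL
  obtain ⟨hn, hs⟩ := pats_spec L
  refine good_contra π ξ hpos hroot (pats L) hn ?_ (Nat.le_of_ble_eq_true h1) hgood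
  intro S hS
  obtain ⟨l, a1, a2, a3, a4, a5⟩ := hs S hS
  have hlen : S.length = l.length := by rw [a2]; simp [stdL]
  refine ⟨?_, a3, by omega, by omega⟩
  rw [a2]
  exact realz_pattern π L hR h2 h3 l a1

end CC

namespace CC

def Sep {V : Type} (f : V → ℕ) (s : Bool) (A B : Finset V) : Prop :=
  ∀ x ∈ A, ∀ y ∈ B, (s = true → f x < f y) ∧ (s = false → f y < f x)

def HasChain {V : Type} (co : Bool → V → ℕ) : ℕ → Bool → Finset V → Finset V → Prop
  | 0, _, _, B => B.Nonempty
  | k + 1, b, A, B => ∃ p ∈ B, ∃ p' ∈ B, p ≠ p' ∧ ∃ A1 A2 : Finset V, A1 ⊆ A ∧ A2 ⊆ A ∧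
      (∀ x ∈ A1, co (!b) x < co (!b) p ∧ co (!b) x < co (!b) p') ∧
      (∀ x ∈ A2, co (!b) p < co (!b) x ∧ co (!b) p' < co (!b) x) ∧
      (HasChain co k (!b) A1 A2 ∨ HasChain co k (!b) A2 A1)

def RF {V : Type} (co : Bool → V → ℕ) (b : Bool) (L : List (ℕ × ℕ)) (F : ℕ × ℕ → V) : Prop :=
  ∀ p ∈ L, ∀ q ∈ L, (p.1 < q.1 → co b (F p) < co b (F q)) ∧
    (p.2 < q.2 → co (!b) (F p) < co (!b) (F q))

lemma chain_succ {V : Type} (co : Bool → V → ℕ) (hinj : ∀ b, Function.Injective (co b)) (k : ℕ)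
    (b : Bool) (A B : Finset V) (h : HasChain co (k + 1) b A B) :
    ∃ p ∈ B, ∃ p' ∈ B, co b p < co b p' ∧ ∃ (s' : Bool) (A1 A2 : Finset V), A1 ⊆ A ∧ A2 ⊆ A ∧
      (∀ x ∈ A1, (s' = true → co (!b) x < co (!b) p ∧ co (!b) x < co (!b) p') ∧
        (s' = false → co (!b) p < co (!b) x ∧ co (!b) p' < co (!b) x)) ∧
      (∀ x ∈ A2, (s' = false → co (!b) x < co (!b) p ∧ co (!b) x < co (!b) p') ∧
        (s' = true → co (!b) p < co (!b) x ∧ co (!b) p' < co (!b) x)) ∧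
      HasChain co k (!b) A1 A2 := by
  obtain ⟨p, hp, p', hp', hne, A1, A2, h1, h2, h3, h4, h5⟩ := h
  have hne' : co b p ≠ co b p' := fun h => hne (hinj b h)
  rcases lt_or_gt_of_ne hne' with hl | hl
  · refine ⟨p, hp, p', hp', hl, ?_⟩
    rcases h5 with h5 | h5
    · exact ⟨true, A1, A2, h1, h2, fun x hx => ⟨fun _ => h3 x hx, by simp⟩,
        fun x hx => ⟨by simp, fun _ => h4 x hx⟩, h5⟩
    · exact ⟨false, A2, A1, h2, h1, fun x hx => ⟨by simp, fun _ => h4 x hx⟩,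
        fun x hx => ⟨fun _ => h3 x hx, by simp⟩, h5⟩
  · refine ⟨p', hp', p, hp, hl, ?_⟩
    rcases h5 with h5 | h5
    · exact ⟨true, A1, A2, h1, h2, fun x hx => ⟨fun _ => (h3 x hx).symm, by simp⟩,
        fun x hx => ⟨by simp, fun _ => (h4 x hx).symm⟩, h5⟩
    · exact ⟨false, A2, A1, h2, h1, fun x hx => ⟨by simp, fun _ => (h4 x hx).symm⟩,
        fun x hx => ⟨fun _ => (h3 x hx).symm, by simp⟩, h5⟩

lemma chain_sep {V : Type} (f : V → ℕ) (p p' : V) (s' : Bool) (A1 A2 : Finset V)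
    (h1 : ∀ x ∈ A1, (s' = true → f x < f p ∧ f x < f p') ∧
        (s' = false → f p < f x ∧ f p' < f x))
    (h2 : ∀ x ∈ A2, (s' = false → f x < f p ∧ f x < f p') ∧
        (s' = true → f p < f x ∧ f p' < f x)) : Sep f s' A1 A2 := by
  intro x hx y hy
  have := h1 x hx
  have := h2 y hy
  constructor <;> intro hs <;> subst hs <;> simp at * <;> omega

lemma chain_realz {V : Type} (co : Bool → V → ℕ) (hinj : ∀ b, Function.Injective (co b)) (k : ℕ) :
    ∀ (_ : k ≤ 8) (b s : Bool) (A B : Finset V), Sep (co b) s A B → HasChain co k b A B →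
    ∃ w : List (Bool × Bool), w.length = k ∧ ∃ F : ℕ × ℕ → V, RF co b (cfg s w) F ∧
      ∀ p ∈ cfg s w, ((F p ∈ B ∧ ext s (k + 1) ≤ p.1 ∧ p.1 ≤ ext s (k + 1) + 1) ∨
        (F p ∈ A ∧ 111 ≤ p.1 + 8 * (k + 1) ∧ p.1 ≤ 89 + 8 * (k + 1))) ∧
        p.2 ≤ 97 + 8 * (k + 1) ∧ 103 ≤ p.2 + 8 * (k + 1) := by
  induction k with
  | zero =>
    intro _ b s A B _ h
    obtain ⟨v, hv⟩ : B.Nonempty := h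
    refine ⟨[], rfl, fun _ => v, ?_, ?_⟩
    · intro p hp q hq
      simp only [cfg, List.mem_singleton] at hp hq
      subst hp hq
      simp
    · intro p hp
      simp only [cfg, List.mem_singleton] at hp
      subst hp
      simp [hv]
  | succ k ih =>
    intro hk b s A B hs h
    obtain ⟨P, hP, P', hP', hPP, s', A1, A2, hA1, hA2, h1, h2, hc⟩ := chain_succ co hinj k b A B h
    obtain ⟨w, hw, F, hF, hI⟩ := ih (by omega) (!b) s' A1 A2 (chain_sep _ P P' s' A1 A2 h1 h2) hc
    have hne : co (!b) P ≠ co (!b) P' := fun h => by rw [hinj _ h] at hPP; exact lt_irrefl _ hPP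
    obtain ⟨d, hd1, hd2⟩ : ∃ d : Bool, (d = true → co (!b) P < co (!b) P') ∧
        (d = false → co (!b) P' < co (!b) P) := by
      rcases lt_or_gt_of_ne hne with h | h
      · exact ⟨true, by simp [h]⟩
      · exact ⟨false, by simp [h]⟩
    let n1 : ℕ × ℕ := (ext s (k + 2), mid s' (k + 1))
    let n2 : ℕ × ℕ := (ext s (k + 2) + 1, bif d then mid s' (k + 1) + 1 else mid s' (k + 1) - 1)
    have hcfg : cfg s ((d, s') :: w) = n1 :: n2 :: (cfg s' w).map Prod.swap := by
      simp [cfg, hw, n1, n2]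
    let G : ℕ × ℕ → V := fun p => if p = n1 then P else if p = n2 then P' else F p.swap
    have hE : ext s (k + 2) = if s then 100 + (8 * (k + 2) + 4) else 100 - (8 * (k + 2) + 4) := by
      cases s <;> rfl
    have hE' : ext s' (k + 1) = if s' then 100 + (8 * (k + 1) + 4) else 100 - (8 * (k + 1) + 4) := by
      cases s' <;> rfl
    have hM : mid s' (k + 1) = if s' then 100 + 8 * (k + 1) else 100 - 8 * (k + 1) := by
      cases s' <;> rfl
    have G1 : G n1 = P := by simp [G]
    have hn21 : n2 ≠ n1 := by
      intro h; have := congrArg Prod.fst h; simp [n1, n2] at this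
    have G2 : G n2 = P' := by simp [G, hn21]
    have hin : ∀ q ∈ cfg s' w, G q.swap = F q := by
      intro q hq
      have := hI q hq
      have hq1 : q.2 ≠ ext s (k + 2) := by rw [hE]; split_ifs <;> omega
      have hq2 : q.2 ≠ ext s (k + 2) + 1 := by rw [hE]; split_ifs <;> omega
      have a1 : q.swap ≠ n1 := fun h => hq1 (congrArg Prod.fst h)
      have a2 : q.swap ≠ n2 := fun h => hq2 (congrArg Prod.fst h)
      simp [G, a1, a2]
    have hFA : ∀ q ∈ cfg s' w, F q ∈ A := by
      intro q hq
      rcases (hI q hq).1 with h | h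
      · exact hA2 h.1
      · exact hA1 h.1
    -- comparison facts
    have cN : ∀ q ∈ cfg s' w, ∀ X : V, (X = P ∨ X = P') → ∀ m : ℕ × ℕ, (m = n1 ∨ m = n2) →
        ((m.1 < q.2 → co b X < co b (F q)) ∧ (m.2 < q.1 → co (!b) X < co (!b) (F q))) ∧
        ((q.2 < m.1 → co b (F q) < co b X) ∧ (q.1 < m.2 → co (!b) (F q) < co (!b) X)) := by
      intro q hq X hX m hm
      have hXB : X ∈ B := by rcases hX with rfl | rfl <;> assumption
      have hsep := hs _ (hFA q hq) X hXB
      have hi := hI q hq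
      have hm1 : ext s (k + 2) ≤ m.1 ∧ m.1 ≤ ext s (k + 2) + 1 := by
        rcases hm with rfl | rfl <;> simp [n1, n2]
      have hm2 : mid s' (k + 1) ≤ m.2 + 1 ∧ m.2 ≤ mid s' (k + 1) + 1 := by
        rcases hm with rfl | rfl
        · simp [n1]
        · cases d <;> simp [n2] <;> omega
      rw [hE] at hm1
      rw [hM] at hm2
      rw [hE'] at hi
      have e1 : F q ∈ A1 → (s' = true → co (!b) (F q) < co (!b) X) ∧
          (s' = false → co (!b) X < co (!b) (F q)) := by
        intro h
        have := h1 _ h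
        rcases hX with rfl | rfl <;> exact ⟨fun h => by simp [h] at this; omega,
          fun h => by simp [h] at this; omega⟩
      have e2 : F q ∈ A2 → (s' = false → co (!b) (F q) < co (!b) X) ∧
          (s' = true → co (!b) X < co (!b) (F q)) := by
        intro h
        have := h2 _ h
        rcases hX with rfl | rfl <;> exact ⟨fun h => by simp [h] at this; omega,
          fun h => by simp [h] at this; omega⟩
      constructor
      · constructor
        · intro hlt
          cases s
          · exact hsep.2 rfl
          · simp at hm1; omega
        · intro hlt
          cases s' <;> rcases hi.1 with h | h <;> simp at hm2 h
          · omega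
          · exact (e1 h.1).2 rfl
          · exact (e2 h.1).2 rfl
          · omega
      · constructor
        · intro hlt
          cases s
          · simp at hm1; omega
          · exact hsep.1 rfl
        · intro hlt
          cases s' <;> rcases hi.1 with h | h <;> simp at hm2 h
          · exact (e2 h.1).1 rfl
          · omega
          · omega
          · exact (e1 h.1).1 rfl
    have hmm : 1 ≤ mid s' (k + 1) := by rw [hM]; split_ifs <;> omega
    refine ⟨(d, s') :: w, by simp [hw], G, ?_, ?_⟩
    · rw [hcfg]
      intro p hp q hq
      simp only [List.mem_cons, List.mem_map] at hp hq
      rcases hp with rfl | rfl | ⟨p, hp, rfl⟩ <;> rcases hq with rfl | rfl | ⟨q, hq, rfl⟩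
      · simp
      · rw [G1, G2]
        refine ⟨fun _ => hPP, fun h => ?_⟩
        cases d
        · simp [n1, n2] at h; omega
        · exact hd1 rfl
      · rw [G1, hin q hq]
        exact (cN q hq P (Or.inl rfl) n1 (Or.inl rfl)).1
      · rw [G1, G2]
        refine ⟨fun h => ?_, fun h => ?_⟩
        · simp [n1, n2] at h
        · cases d
          · exact hd2 rfl
          · simp [n1, n2] at h
      · simp
      · rw [G2, hin q hq]
        exact (cN q hq P' (Or.inr rfl) n2 (Or.inr rfl)).1
      · rw [G1, hin p hp]
        exact (cN p hp P (Or.inl rfl) n1 (Or.inl rfl)).2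
      · rw [G2, hin p hp]
        exact (cN p hp P' (Or.inr rfl) n2 (Or.inr rfl)).2
      · rw [hin p hp, hin q hq]
        have := hF p hp q hq
        rw [Bool.not_not] at this
        exact ⟨this.2, this.1⟩
    · rw [hcfg]
      intro p hp
      simp only [List.mem_cons, List.mem_map] at hp
      rcases hp with rfl | rfl | ⟨p, hp, rfl⟩
      · rw [G1]
        refine ⟨Or.inl ⟨hP, by simp [n1]⟩, ?_⟩
        simp only [n1, hM]
        split_ifs <;> omega
      · rw [G2]
        refine ⟨Or.inl ⟨hP', by simp [n2]⟩, ?_⟩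
        have : mid s' (k + 1) ≤ n2.2 + 1 ∧ n2.2 ≤ mid s' (k + 1) + 1 := by
          cases d <;> simp [n2] <;> omega
        rw [hM] at this
        split_ifs at this <;> omega
      · rw [hin p hp]
        have := hI p hp
        rw [hE'] at this
        refine ⟨Or.inr ⟨hFA p hp, ?_⟩, ?_⟩
        · simp only [Prod.fst_swap]; omega
        · simp only [Prod.snd_swap]; split_ifs at this <;> omega

lemma pco_inj (π : Permu) (b : Bool) : Function.Injective (pco π b) := by
  intro x y h
  cases b
  · simp only [pco, Bool.false_eq_true, if_false] at h
    exact π.2.injective (Fin.ext h)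
  · simp only [pco, if_true] at h
    exact Fin.ext h

lemma realz_swap {V : Type} {co : Bool → V → ℕ} {b : Bool} {L : List (ℕ × ℕ)}
    (h : Realz co b L) : Realz co (!b) (L.map Prod.swap) := by
  obtain ⟨F, hF⟩ := h
  refine ⟨fun p => F p.swap, ?_⟩
  intro p hp q hq
  obtain ⟨p, hp1, rfl⟩ := List.mem_map.1 hp
  obtain ⟨q, hq1, rfl⟩ := List.mem_map.1 hq
  simp only [Prod.swap_swap, Bool.not_not, Prod.fst_swap, Prod.snd_swap]
  exact (hF p hp1 q hq1).symm

lemma mem_bools (b : Bool) : b ∈ bools := by cases b <;> simp [bools]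
lemma mem_pairsB (b : Bool × Bool) : b ∈ pairsB := by
  obtain ⟨a, b⟩ := b
  cases a <;> cases b <;> simp [pairsB]

def NoR {V : Type} (co : Bool → V → ℕ) : Prop := ∀ L, wtOK L = true → ¬ Realz co true L

lemma no_chain4 {V : Type} (co : Bool → V → ℕ) (hinj : ∀ b, Function.Injective (co b))
    (hN : NoR co) (s : Bool) (A B : Finset V) (hs : Sep (co true) s A B) :
    ¬ HasChain co 4 true A B := by
  intro h
  obtain ⟨w, hw, F, hF, -⟩ := chain_realz co hinj 4 (by norm_num) true s A B hs h
  match w, hw with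
  | [(d, s'), x, y, z], _ =>
    have ht := tree4_ok
    unfold tree4 at ht
    have := List.all_eq_true.1 (List.all_eq_true.1 (List.all_eq_true.1 (List.all_eq_true.1 ht
      s' (mem_bools _)) x (mem_pairsB _)) y (mem_pairsB _)) z (mem_pairsB _)
    rcases Bool.or_eq_true_iff.1 this with h1 | h1
    · refine hN _ h1 ⟨F, fun p hp q hq => hF p ?_ q ?_⟩ <;> simp only [cfg, List.mem_cons] <;>
        right <;> right <;> assumption
    · have := List.all_eq_true.1 (List.all_eq_true.1 h1 s (mem_bools _)) d (mem_bools _)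
      exact hN _ this ⟨F, hF⟩

lemma no_chain5 {V : Type} (co : Bool → V → ℕ) (hinj : ∀ b, Function.Injective (co b))
    (hN : NoR co) (A B : Finset V) : ¬ HasChain co 5 false A B := by
  intro h
  obtain ⟨P, hP, P', hP', hPP, s', A1, A2, hA1, hA2, h1, h2, hc⟩ := chain_succ co hinj 4 false A B h
  exact no_chain4 co hinj hN s' A1 A2 (chain_sep _ P P' s' A1 A2 h1 h2) hc

/-- Erdos-Szekeres -/
lemma es {V : Type} [DecidableEq V] (S : Finset V) (f g : V → ℕ) (r : ℕ)
    (hf : ∀ x ∈ S, ∀ y ∈ S, f x = f y → x = y) (hg : ∀ x ∈ S, ∀ y ∈ S, g x = g y → x = y)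
    (hS : r * r < S.card) : ∃ T ⊆ S, T.card = r + 1 ∧ ∃ i : Bool, ∀ x ∈ T, ∀ y ∈ T, f x < f y →
      (i = true → g x < g y) ∧ (i = false → g y < g x) := by
  classical
  let Ch : Bool → Finset V → Prop := fun i T => ∀ x ∈ T, ∀ y ∈ T, f x < f y →
      (i = true → g x < g y) ∧ (i = false → g y < g x)
  by_contra hcon
  push Not at hcon
  have hle : ∀ i T, T ⊆ S → Ch i T → T.card ≤ r := by
    intro i T hT hc
    by_contra hlt
    obtain ⟨U, hU, hUc⟩ := Finset.exists_subset_card_eq (s := T) (n := r + 1) (by omega)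
    obtain ⟨x, hx, y, hy, hxy, h⟩ := hcon U (hU.trans hT) hUc i
    have := hc x (hU hx) y (hU hy) hxy
    exact absurd this.2 (by have := h this.1; push Not; exact ⟨this.1, by omega⟩)
  let Q : Bool → V → Finset (Finset V) := fun i x =>
    S.powerset.filter (fun T => Ch i T ∧ x ∈ T ∧ ∀ y ∈ T, f y ≤ f x)
  let lab : Bool → V → ℕ := fun i x => (Q i x).sup Finset.card
  have hone : ∀ i, ∀ x ∈ S, {x} ∈ Q i x := by
    intro i x hx
    simp only [Q, Finset.mem_filter, Finset.mem_powerset, Finset.singleton_subset_iff, hx,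
      Finset.mem_singleton, true_and, forall_eq, le_refl, and_true]
    intro a ha b hb hab
    simp only [Finset.mem_singleton] at ha hb
    subst ha hb
    omega
  have hl1 : ∀ i, ∀ x ∈ S, 1 ≤ lab i x := fun i x hx => by
    have := Finset.le_sup (f := Finset.card) (hone i x hx)
    rwa [Finset.card_singleton] at this
  have hl2 : ∀ i, ∀ x ∈ S, lab i x ≤ r := fun i x hx => by
    apply Finset.sup_le
    intro T hT
    simp only [Q, Finset.mem_filter, Finset.mem_powerset] at hT
    exact hle i T hT.1 hT.2.1
  have hstep : ∀ i, ∀ x ∈ S, ∀ y ∈ S, f x < f y → ((i = true → g x < g y) ∧ (i = false → g y < g x)) →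
      lab i x < lab i y := by
    intro i x hx y hy hxy hg'
    obtain ⟨T, hT, hTe⟩ := Finset.exists_mem_eq_sup (Q i x) ⟨_, hone i x hx⟩ Finset.card
    simp only [Q, Finset.mem_filter, Finset.mem_powerset] at hT
    obtain ⟨t1, t2, t3, t4⟩ := hT
    have hyT : y ∉ T := fun h => by have := t4 y h; omega
    have : insert y T ∈ Q i y := by
      simp only [Q, Finset.mem_filter, Finset.mem_powerset]
      refine ⟨Finset.insert_subset hy t1, ?_, Finset.mem_insert_self _ _, ?_⟩
      · intro a ha b hb hab
        rcases Finset.mem_insert.1 ha with rfl | ha2 <;> rcases Finset.mem_insert.1 hb with rfl | hb2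
        · omega
        · have := t4 b hb2; omega
        · rcases Nat.lt_or_ge (f a) (f x) with h | h
          · have := t2 a ha2 x t3 h
            refine ⟨fun h => lt_trans (this.1 h) (hg'.1 h), fun h => lt_trans (hg'.2 h) (this.2 h)⟩
          · have : a = x := hf a (t1 ha2) x hx (le_antisymm (t4 a ha2) h)
            rw [this]; exact hg'
        · exact t2 a ha2 b hb2 hab
      · intro a ha
        rcases Finset.mem_insert.1 ha with rfl | ha
        · exact le_refl _
        · have := t4 a ha; omega
    have h1 := Finset.le_sup (f := Finset.card) this
    rw [Finset.card_insert_of_notMem hyT] at h1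
    change lab i x = _ at hTe
    change _ ≤ lab i y at h1
    omega
  have hmaps : ∀ x ∈ S, (lab true x, lab false x) ∈ Finset.Icc 1 r ×ˢ Finset.Icc 1 r := by
    intro x hx
    simp only [Finset.mem_product, Finset.mem_Icc]
    exact ⟨⟨hl1 _ x hx, hl2 _ x hx⟩, ⟨hl1 _ x hx, hl2 _ x hx⟩⟩
  have hinjo : Set.InjOn (fun x => (lab true x, lab false x)) S := by
    have key : ∀ x ∈ S, ∀ y ∈ S, f x < f y → (lab true x, lab false x) = (lab true y, lab false y) →
        False := by
      intro x hx y hy hxy he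
      have e1 := congrArg Prod.fst he
      have e2 := congrArg Prod.snd he
      simp only at e1 e2
      rcases lt_trichotomy (g x) (g y) with h | h | h
      · have := hstep true x hx y hy hxy (by simp [h]); omega
      · rw [hg x hx y hy h] at hxy; omega
      · have := hstep false x hx y hy hxy (by simp [h]); omega
    intro x hx y hy he
    rcases lt_trichotomy (f x) (f y) with h | h | h
    · exact (key x hx y hy h he).elim
    · exact hf x hx y hy h
    · exact (key y hy x hx h he.symm).elim
  have := Finset.card_le_card_of_injOn _ hmaps hinjo
  rw [Finset.card_product, Nat.card_Icc] at this
  simp at this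
  omega

open Classical in
noncomputable def starts {V : Type} (f : V → ℕ) (A B : Finset V) : Finset V :=
  B.filter fun y => ∃ x ∈ A, f x < f y ∧ ∀ w ∈ A ∪ B, ¬ (f x < f w ∧ f w < f y)

lemma no_alt {V : Type} [DecidableEq V] (co : Bool → V → ℕ)
    (hinj : ∀ b, Function.Injective (co b))
    (hN : NoR co) (b s : Bool) (A B : Finset V) (hs : Sep (co b) s A B) :
    (starts (co (!b)) A B).card ≤ 256 := by
  classical
  by_contra hlt
  have hmem : ∀ y ∈ starts (co (!b)) A B, y ∈ B ∧ ∃ x ∈ A, co (!b) x < co (!b) y ∧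
      ∀ w ∈ A ∪ B, ¬ (co (!b) x < co (!b) w ∧ co (!b) w < co (!b) y) := by
    intro y hy
    simpa [starts] using hy
  have hdis : ∀ x ∈ A, x ∉ B := by
    intro x hx hx'
    have := hs x hx x hx'
    cases s
    · exact lt_irrefl _ (this.2 rfl)
    · exact lt_irrefl _ (this.1 rfl)
  set S := starts (co (!b)) A B with hSdef
  have : ∀ y, ∃ x, y ∈ S → x ∈ A ∧ co (!b) x < co (!b) y ∧
      ∀ w ∈ A ∪ B, ¬ (co (!b) x < co (!b) w ∧ co (!b) w < co (!b) y) := by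
    intro y
    by_cases hy : y ∈ S
    · obtain ⟨_, x, h⟩ := hmem y hy
      exact ⟨x, fun _ => h⟩
    · exact ⟨y, fun h => (hy h).elim⟩
  choose pr hpr using this
  have hlt2 : ∀ y ∈ S, ∀ y' ∈ S, co (!b) y < co (!b) y' → co (!b) y < co (!b) (pr y') := by
    intro y hy y' hy' h
    obtain ⟨a1, a2, a3⟩ := hpr y' hy'
    have h1 := a3 y (Finset.mem_union_right _ (hmem y hy).1)
    have h2 : co (!b) y ≠ co (!b) (pr y') := fun h => by
      rw [← hinj _ h] at a1
      exact hdis _ a1 (hmem y hy).1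
    omega
  have hprinj : ∀ x ∈ S, ∀ y ∈ S, co b (pr x) = co b (pr y) → x = y := by
    intro x hx y hy h
    have h := hinj _ h
    rcases lt_trichotomy (co (!b) x) (co (!b) y) with h1 | h1 | h1
    · have := hlt2 x hx y hy h1
      have := (hpr x hx).2.1
      rw [h] at this; omega
    · exact hinj _ h1
    · have := hlt2 y hy x hx h1
      have := (hpr y hy).2.1
      rw [h] at *; omega
  obtain ⟨T1, hT1, hc1, j, hj⟩ := es S (co (!b)) (co b) 16 (fun x _ y _ h => hinj _ h)
    (fun x _ y _ h => hinj _ h) (by omega)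
  obtain ⟨T, hT, hc, i, hi⟩ := es T1 (co (!b)) (fun x => co b (pr x)) 4 (fun x _ y _ h => hinj _ h)
    (fun x hx y hy h => hprinj x (hT1 hx) y (hT1 hy) h) (by omega)
  have hTS : T ⊆ S := hT.trans hT1
  have himc : (T.image (co (!b))).card = 5 := by
    rw [Finset.card_image_of_injective _ (hinj _), hc]
  let e := (T.image (co (!b))).orderEmbOfFin himc
  have hpre : ∀ m : ℕ, ∃ v, v ∈ T ∧ ∀ hm : m < 5, co (!b) v = e ⟨m, hm⟩ := by
    intro m
    by_cases hm : m < 5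
    · have := Finset.orderEmbOfFin_mem (T.image (co (!b))) himc ⟨m, hm⟩
      obtain ⟨v, hv, he⟩ := Finset.mem_image.1 this
      exact ⟨v, hv, fun _ => he⟩
    · obtain ⟨v, hv⟩ : T.Nonempty := Finset.card_pos.1 (by omega)
      exact ⟨v, hv, fun h => (hm h).elim⟩
  choose y hyT hye using hpre
  have hmono : ∀ m m', m < m' → m' < 5 → co (!b) (y m) < co (!b) (y m') := by
    intro m m' h h'
    rw [hye m (by omega), hye m' h']
    exact e.strictMono h
  have R : Realz co b (altC s i j) := by
    let F : ℕ × ℕ → V := fun p => if p.2 % 2 = 0 then pr (y (p.2 / 2)) else y (p.2 / 2)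
    have F0 : ∀ a m, F (a, 2 * m) = pr (y m) := by intro a m; simp [F]
    have F1 : ∀ a m, F (a, 2 * m + 1) = y m := by
      intro a m
      have h1 : (2 * m + 1) % 2 ≠ 0 := by omega
      have h2 : (2 * m + 1) / 2 = m := by omega
      simp only [F, h2, if_neg h1]
    have hy5 := fun m => hTS (hyT m)
    have xA := fun m => (hpr (y m) (hy5 m)).1
    have xlt := fun m => (hpr (y m) (hy5 m)).2.1
    have yB := fun m => (hmem (y m) (hy5 m)).1
    have c2 : ∀ m m', m < m' → m' < 5 → co (!b) (y m) < co (!b) (pr (y m')) := fun m m' h h' =>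
      hlt2 _ (hy5 m) _ (hy5 m') (hmono m m' h h')
    have cj := fun m m' (h : m < m') (h' : m' < 5) =>
      hj _ (hT (hyT m)) _ (hT (hyT m')) (hmono m m' h h')
    have ci := fun m m' (h : m < m') (h' : m' < 5) => hi _ (hyT m) _ (hyT m') (hmono m m' h h')
    refine ⟨F, ?_⟩
    intro p hp q hq
    simp only [altC, List.mem_append, List.mem_map, List.mem_range] at hp hq
    rcases hp with ⟨m, hm, rfl⟩ | ⟨m, hm, rfl⟩ <;> rcases hq with ⟨m', hm', rfl⟩ | ⟨m', hm', rfl⟩ <;>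
      simp only [F0, F1]
    · constructor
      · intro h
        cases i
        · have : m' < m := by simp at h; omega
          exact (ci m' m this hm).2 rfl
        · have : m < m' := by simp at h; omega
          exact (ci m m' this hm').1 rfl
      · intro h
        exact lt_trans (xlt m) (c2 m m' (by omega) hm')
    · constructor
      · intro h
        cases s
        · exfalso; cases i <;> cases j <;> simp at h <;> omega
        · exact (hs _ (xA m) _ (yB m')).1 rfl
      · intro h
        rcases Nat.lt_or_ge m m' with h1 | h1
        · exact lt_trans (xlt m) (hmono m m' h1 hm')
        · have : m = m' := by omega
          subst this; exact xlt m
    · constructor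
      · intro h
        cases s
        · exact (hs _ (xA m') _ (yB m)).2 rfl
        · exfalso; cases i <;> cases j <;> simp at h <;> omega
      · intro h
        exact c2 m m' (by omega) hm'
    · constructor
      · intro h
        cases j
        · have : m' < m := by simp at h; omega
          exact (cj m' m this hm).2 rfl
        · have : m < m' := by simp at h; omega
          exact (cj m m' this hm').1 rfl
      · intro h
        exact hmono m m' (by omega) hm'
  have hall := altAll_ok
  unfold altAll at hall
  have h3 := List.all_eq_true.1 (List.all_eq_true.1 (List.all_eq_true.1 hall s (mem_bools _))
    i (mem_bools _)) j (mem_bools _)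
  obtain ⟨w1, w2⟩ := Bool.and_eq_true_iff.1 h3
  cases b
  · exact hN _ w2 (realz_swap R)
  · exact hN _ w1 R

end CC

namespace CC

lemma mem_starts {V : Type} [DecidableEq V] {f : V → ℕ} {A B : Finset V} {y : V} :
    y ∈ starts f A B ↔ y ∈ B ∧ ∃ x ∈ A, f x < f y ∧ ∀ w, w ∈ A ∨ w ∈ B →
      ¬ (f x < f w ∧ f w < f y) := by
  simp only [starts, Finset.mem_filter, Finset.mem_union]

def Thick {V : Type} (f : V → ℕ) (A B : Finset V) : Prop :=
  ∀ y ∈ starts f A B, (∃ z ∈ A, f y < f z) →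
    ∃ y' ∈ B, f y < f y' ∧ ∀ w, w ∈ A ∨ w ∈ B → ¬ (f y < f w ∧ f w < f y')

lemma thick_step {V : Type} [DecidableEq V] (f : V → ℕ) (hf : Function.Injective f)
    (A B : Finset V) (hd : Disjoint A B) (h : ¬ Thick f A B) :
    ∃ y ∈ B, (starts f A (B.erase y)).card + (starts f (B.erase y) A).card + 1 ≤
      (starts f A B).card + (starts f B A).card := by
  have hd' : ∀ x ∈ A, ∀ y ∈ B, f x ≠ f y := fun x hx y hy h =>
    Finset.disjoint_left.1 hd hx (hf h ▸ hy)
  unfold Thick at h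
  push Not at h
  obtain ⟨y, hy, ⟨z0, hz0, hyz0⟩, hno⟩ := h
  obtain ⟨hyB, p, hp, hpy, hpn⟩ := mem_starts.1 hy
  obtain ⟨z, hz, hzmin⟩ := Finset.exists_min_image ((A ∪ B).filter fun w => f y < f w) f
    ⟨z0, by simp [hz0, hyz0]⟩
  simp only [Finset.mem_filter, Finset.mem_union] at hz hzmin
  have hzA : z ∈ A := by
    rcases hz.1 with h | h
    · exact h
    · obtain ⟨w, hw, hw1, hw2⟩ := hno z h hz.2
      have := hzmin w ⟨hw, hw1⟩
      omega
  have hzst : z ∈ starts f B A := by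
    refine mem_starts.2 ⟨hzA, y, hyB, hz.2, ?_⟩
    rintro w hw ⟨h1, h2⟩
    have := hzmin w ⟨hw.symm, h1⟩
    omega
  refine ⟨y, hyB, ?_⟩
  have s1 : starts f A (B.erase y) ⊆ (starts f A B).erase y := by
    intro v hv
    obtain ⟨hvB, x, hx, hxv, hn⟩ := mem_starts.1 hv
    obtain ⟨hvy, hvB2⟩ := Finset.mem_erase.1 hvB
    refine Finset.mem_erase.2 ⟨hvy, mem_starts.2 ⟨hvB2, x, hx, hxv, ?_⟩⟩
    intro w hw hh
    by_cases hwy : w = y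
    · subst hwy
      have h1 := hzmin v ⟨Or.inr hvB2, hh.2⟩
      have h2 := hd' z hzA v hvB2
      exact hn z (Or.inl hzA) ⟨by omega, by omega⟩
    · exact hn w (by simpa [hwy] using hw) hh
  have s2 : starts f (B.erase y) A ⊆ (starts f B A).erase z := by
    intro v hv
    obtain ⟨hvA, x, hx, hxv, hn⟩ := mem_starts.1 hv
    obtain ⟨hxy, hxB⟩ := Finset.mem_erase.1 hx
    have key : ¬ (f x < f y ∧ f y < f v) := by
      rintro ⟨h1, h2⟩
      have h3 := hpn x (Or.inr hxB)
      have h4 := hd' p hp x hxB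
      exact hn p (Or.inr hp) ⟨by omega, by omega⟩
    refine Finset.mem_erase.2 ⟨?_, mem_starts.2 ⟨hvA, x, hxB, hxv, ?_⟩⟩
    · rintro rfl
      have h1 : f x ≠ f y := fun h => hxy (hf h)
      rcases lt_or_gt_of_ne h1 with h | h
      · exact key ⟨h, hz.2⟩
      · have := hzmin x ⟨Or.inr hxB, h⟩
        omega
    · intro w hw hh
      by_cases hwy : w = y
      · subst hwy
        exact key hh
      · exact hn w (by simpa [hwy] using hw) hh
  have c1 := Finset.card_le_card s1
  have c2 := Finset.card_le_card s2
  rw [Finset.card_erase_of_mem hy] at c1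
  rw [Finset.card_erase_of_mem hzst] at c2
  have := Finset.card_pos.2 ⟨_, hy⟩
  omega

lemma thicken {V : Type} [DecidableEq V] (f : V → ℕ) (hf : Function.Injective f) (m : ℕ) :
    ∀ A B : Finset V, Disjoint A B → (starts f A B).card + (starts f B A).card ≤ m →
    ∃ A' ⊆ A, ∃ B' ⊆ B, (A \ A').card + (B \ B').card ≤ m ∧
      (starts f A' B').card + (starts f B' A').card ≤ m ∧ Thick f A' B' ∧ Thick f B' A' := by
  induction m with
  | zero =>
    intro A B hd h
    refine ⟨A, subset_refl _, B, subset_refl _, by simp, h, ?_, ?_⟩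
    · intro y hy
      have := Finset.card_pos.2 ⟨_, hy⟩
      omega
    · intro y hy
      have := Finset.card_pos.2 ⟨_, hy⟩
      omega
  | succ m ih =>
    intro A B hd h
    by_cases h1 : Thick f A B
    · by_cases h2 : Thick f B A
      · exact ⟨A, subset_refl _, B, subset_refl _, by simp, h, h1, h2⟩
      · obtain ⟨y, hy, hc⟩ := thick_step f hf B A hd.symm h2
        obtain ⟨A', hA', B', hB', e1, e2, e3, e4⟩ := ih (A.erase y) B
          (hd.mono_left (Finset.erase_subset _ _)) (by omega)
        refine ⟨A', hA'.trans (Finset.erase_subset _ _), B', hB', ?_, by omega, e3, e4⟩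
        have : A \ A' ⊆ insert y (A.erase y \ A') := by
          intro x hx
          simp only [Finset.mem_sdiff, Finset.mem_insert, Finset.mem_erase] at hx ⊢
          tauto
        have := (Finset.card_le_card this).trans (Finset.card_insert_le _ _)
        omega
    · obtain ⟨y, hy, hc⟩ := thick_step f hf A B hd h1
      obtain ⟨A', hA', B', hB', e1, e2, e3, e4⟩ := ih A (B.erase y)
        (hd.mono_right (Finset.erase_subset _ _)) (by omega)
      refine ⟨A', hA', B', hB'.trans (Finset.erase_subset _ _), ?_, by omega, e3, e4⟩
      have : B \ B' ⊆ insert y (B.erase y \ B') := by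
        intro x hx
        simp only [Finset.mem_sdiff, Finset.mem_insert, Finset.mem_erase] at hx ⊢
        tauto
      have := (Finset.card_le_card this).trans (Finset.card_insert_le _ _)
      omega

/-- `col` is a convex colouring of `(A ∪ B) \ D` separating `A` from `B` -/
def IsCol {V κ : Type} (co : Bool → V → ℕ) (A B D : Finset V) (col : V → κ) : Prop :=
  (∀ b x y z, (x ∈ A ∨ x ∈ B) → (y ∈ A ∨ y ∈ B) → (z ∈ A ∨ z ∈ B) → x ∉ D → y ∉ D → z ∉ D →
    co b x < co b y → co b y < co b z → col x = col z → col y = col x) ∧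
  ∀ x ∈ A, ∀ y ∈ B, x ∉ D → y ∉ D → col x ≠ col y

def SepCol {V : Type} (co : Bool → V → ℕ) (q r : ℕ) (A B : Finset V) : Prop :=
  ∃ D : Finset V, D.card ≤ r ∧ ∃ col : V → Fin q, IsCol co A B D col

lemma IsCol.comp {V κ κ' : Type} {co : Bool → V → ℕ} {A B D : Finset V} {col : V → κ}
    (h : IsCol co A B D col) (e : κ → κ') (he : Function.Injective e) :
    IsCol co A B D (fun x => e (col x)) := by
  refine ⟨?_, fun x hx y hy h1 h2 h3 => h.2 x hx y hy h1 h2 (he h3)⟩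
  intro b x y z h1 h2 h3 h4 h5 h6 h7 h8 h9
  exact congrArg e (h.1 b x y z h1 h2 h3 h4 h5 h6 h7 h8 (he h9))

lemma sepCol_of {V κ : Type} [Fintype κ] {co : Bool → V → ℕ} {A B D : Finset V} {col : V → κ}
    {q r : ℕ} (h : IsCol co A B D col) (hD : D.card ≤ r) (hq : Fintype.card κ ≤ q) :
    SepCol co q r A B :=
  ⟨D, hD, _, h.comp (fun k => Fin.castLE hq (Fintype.equivFin κ k))
    ((Fin.castLE_injective hq).comp (Fintype.equivFin κ).injective)⟩

lemma SepCol.mono {V : Type} {co : Bool → V → ℕ} {A B : Finset V} {q r q' r' : ℕ}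
    (h : SepCol co q r A B) (hq : q ≤ q') (hr : r ≤ r') : SepCol co q' r' A B := by
  obtain ⟨D, hD, col, hc⟩ := h
  exact sepCol_of hc (hD.trans hr) (by simpa using hq)

open Classical in
noncomputable def cuts {V : Type} (f : V → ℕ) (A B : Finset V) : Finset V :=
  (starts f A B).filter fun y => ∃ z ∈ A, f y < f z

lemma side {V : Type} [DecidableEq V] (co : Bool → V → ℕ)
    (hinj : ∀ b, Function.Injective (co b)) (q : ℕ) (b s : Bool) (A B D : Finset V)
    (hs : Sep (co b) s A B) (De : V → Finset V) (ce : V → V → Fin q)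
    (hc : ∀ e ∈ cuts (co (!b)) A B, De e ⊆ D ∧ IsCol co (A.filter fun a => co (!b) a < co (!b) e)
      (A.filter fun a => co (!b) e < co (!b) a) (De e) (ce e))
    (c : Bool) (x y z : V) (hx : x ∈ A) (hz : z ∈ A) (hy : y ∈ A ∨ y ∈ B) (hxD : x ∉ D)
    (hyD : y ∉ D) (hzD : z ∉ D) (hxy : co c x < co c y) (hyz : co c y < co c z)
    (hcol : ∀ e ∈ cuts (co (!b)) A B, ce e x = ce e z) :
    y ∈ A ∧ ∀ e ∈ cuts (co (!b)) A B, ce e y = ce e x := by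
  have hdis : ∀ x ∈ A, x ∉ B := by
    intro x hx hx'
    have := hs x hx x hx'
    cases s
    · exact lt_irrefl _ (this.2 rfl)
    · exact lt_irrefl _ (this.1 rfl)
  have hcB : ∀ e ∈ cuts (co (!b)) A B, e ∈ B := by
    intro e he
    simp only [cuts, Finset.mem_filter] at he
    exact (mem_starts.1 he.1).1
  have hyA : y ∈ A := by
    rcases hy with h | hyB
    · exact h
    exfalso
    by_cases hcb : c = b
    · subst hcb
      have h1 := hs x hx y hyB
      have h2 := hs z hz y hyB
      cases s
      · have := h1.2 rfl; omega
      · have := h2.1 rfl; omega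
    · have hcb : c = !b := by cases b <;> cases c <;> simp_all
      subst hcb
      obtain ⟨a, ha, hamax⟩ := Finset.exists_max_image
        (A.filter fun a => co (!b) a < co (!b) y) (co (!b)) ⟨x, by simp [hx, hxy]⟩
      simp only [Finset.mem_filter] at ha hamax
      obtain ⟨e, he, hemin⟩ := Finset.exists_min_image
        (B.filter fun w => co (!b) a < co (!b) w) (co (!b)) ⟨y, by simp [hyB, ha.2]⟩
      simp only [Finset.mem_filter] at he hemin
      have hey := hemin y ⟨hyB, ha.2⟩
      have hxa := hamax x ⟨hx, hxy⟩
      have hecut : e ∈ cuts (co (!b)) A B := by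
        simp only [cuts, Finset.mem_filter]
        refine ⟨mem_starts.2 ⟨he.1, a, ha.1, he.2, ?_⟩, z, hz, by omega⟩
        rintro w (hw | hw) ⟨h1, h2⟩
        · have := hamax w ⟨hw, by omega⟩; omega
        · have := hemin w ⟨hw, h1⟩; omega
      obtain ⟨h1, h2⟩ := hc e hecut
      refine h2.2 x ?_ z ?_ (fun h => hxD (h1 h)) (fun h => hzD (h1 h)) (hcol e hecut)
      · simp only [Finset.mem_filter]; exact ⟨hx, by omega⟩
      · simp only [Finset.mem_filter]; exact ⟨hz, by omega⟩
  refine ⟨hyA, fun e he => ?_⟩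
  obtain ⟨h1, h2⟩ := hc e he
  have hm : ∀ v ∈ A, v ∈ A.filter (fun a => co (!b) a < co (!b) e) ∨
      v ∈ A.filter (fun a => co (!b) e < co (!b) a) := by
    intro v hv
    have : co (!b) v ≠ co (!b) e := fun h => hdis v hv (hinj _ h ▸ hcB e he)
    simp only [Finset.mem_filter, hv, true_and]
    omega
  exact h2.1 c x y z (hm x hx) (hm y hyA) (hm z hz) (fun h => hxD (h1 h)) (fun h => hyD (h1 h))
    (fun h => hzD (h1 h)) hxy hyz (hcol e he)

lemma Sep.symm {V : Type} {f : V → ℕ} {s : Bool} {A B : Finset V} (h : Sep f s A B) :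
    Sep f (!s) B A := by
  intro x hx y hy
  have := h y hy x hx
  cases s
  · exact ⟨fun _ => this.2 rfl, by simp⟩
  · exact ⟨by simp, fun _ => this.1 rfl⟩

lemma Sep.mono {V : Type} {f : V → ℕ} {s : Bool} {A B A' B' : Finset V} (h : Sep f s A B)
    (hA : A' ⊆ A) (hB : B' ⊆ B) : Sep f s A' B' :=
  fun x hx y hy => h x (hA hx) y (hB hy)

lemma Sep.disj {V : Type} [DecidableEq V] {f : V → ℕ} {s : Bool} {A B : Finset V}
    (h : Sep f s A B) : Disjoint A B := by
  rw [Finset.disjoint_left]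
  intro x hx hx'
  have := h x hx x hx'
  cases s
  · exact lt_irrefl _ (this.2 rfl)
  · exact lt_irrefl _ (this.1 rfl)

/-- choose the colourings attached to the cuts -/
lemma cut_fun {V : Type} [DecidableEq V] (co : Bool → V → ℕ) (q r : ℕ) (hq : 0 < q) (T : Finset V)
    (L U : V → Finset V) (h : ∀ e ∈ T, SepCol co q r (L e) (U e)) :
    ∃ (De : V → Finset V) (ce : V → V → Fin q), (∀ e ∈ T, (De e).card ≤ r) ∧
      ∀ e ∈ T, IsCol co (L e) (U e) (De e) (ce e) := by
  have : ∀ e, ∃ (D : Finset V) (c : V → Fin q), e ∈ T → D.card ≤ r ∧ IsCol co (L e) (U e) D c := by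
    intro e
    by_cases he : e ∈ T
    · obtain ⟨D, hD, c, hc⟩ := h e he
      exact ⟨D, c, fun _ => ⟨hD, hc⟩⟩
    · exact ⟨∅, fun _ => ⟨0, hq⟩, fun h => (he h).elim⟩
  choose De ce hh using this
  exact ⟨De, ce, fun e he => (hh e he).1, fun e he => (hh e he).2⟩

lemma combine {V : Type} [DecidableEq V] (co : Bool → V → ℕ)
    (hinj : ∀ b, Function.Injective (co b)) (q r N : ℕ) (hq : 0 < q) (b s : Bool) (A B : Finset V)
    (hs : Sep (co b) s A B)
    (hA : ∀ e ∈ cuts (co (!b)) A B, SepCol co q r (A.filter fun a => co (!b) a < co (!b) e)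
      (A.filter fun a => co (!b) e < co (!b) a))
    (hB : ∀ e ∈ cuts (co (!b)) B A, SepCol co q r (B.filter fun a => co (!b) a < co (!b) e)
      (B.filter fun a => co (!b) e < co (!b) a))
    (hcA : (cuts (co (!b)) A B).card ≤ N) (hcB : (cuts (co (!b)) B A).card ≤ N) :
    SepCol co (q ^ N + q ^ N) (N * r + N * r) A B := by
  classical
  obtain ⟨DA, cA, a1, a2⟩ := cut_fun co q r hq _ _ _ hA
  obtain ⟨DB, cB, b1, b2⟩ := cut_fun co q r hq _ _ _ hB
  set TA := cuts (co (!b)) A B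
  set TB := cuts (co (!b)) B A
  let D := TA.biUnion DA ∪ TB.biUnion DB
  have hD : D.card ≤ N * r + N * r := by
    refine (Finset.card_union_le _ _).trans (Nat.add_le_add ?_ ?_)
    · exact (Finset.card_biUnion_le_card_mul _ _ _ a1).trans (Nat.mul_le_mul_right _ hcA)
    · exact (Finset.card_biUnion_le_card_mul _ _ _ b1).trans (Nat.mul_le_mul_right _ hcB)
  have hDA : ∀ e ∈ TA, DA e ⊆ D := fun e he =>
    (Finset.subset_biUnion_of_mem DA he).trans Finset.subset_union_left
  have hDB : ∀ e ∈ TB, DB e ⊆ D := fun e he =>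
    (Finset.subset_biUnion_of_mem DB he).trans Finset.subset_union_right
  have hdis : ∀ x ∈ B, x ∉ A := fun x hx hx' => Finset.disjoint_left.1 hs.disj hx' hx
  let col : V → (TA → Fin q) ⊕ (TB → Fin q) := fun x =>
    if x ∈ A then Sum.inl (fun e => cA e x) else Sum.inr (fun e => cB e x)
  have colA : ∀ x ∈ A, col x = Sum.inl (fun e : TA => cA e x) := fun x hx => if_pos hx
  have colB : ∀ x ∈ B, col x = Sum.inr (fun e : TB => cB e x) := fun x hx => if_neg (hdis x hx)
  refine sepCol_of (col := col) (D := D) ⟨?_, ?_⟩ hD ?_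
  · intro c x y z hx hy hz hxD hyD hzD hxy hyz hcol
    rcases hx with hx | hx <;> rcases hz with hz | hz
    · rw [colA x hx, colA z hz] at hcol
      have hcol := Sum.inl_injective hcol
      obtain ⟨h1, h2⟩ := side co hinj q b s A B D hs DA cA (fun e he => ⟨hDA e he, a2 e he⟩) c x y z
        hx hz hy hxD hyD hzD hxy hyz (fun e he => congrFun hcol ⟨e, he⟩)
      rw [colA x hx, colA y h1]
      congr 1
      funext e
      exact h2 e e.2
    · rw [colA x hx, colB z hz] at hcol
      simp at hcol
    · rw [colB x hx, colA z hz] at hcol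
      simp at hcol
    · rw [colB x hx, colB z hz] at hcol
      have hcol := Sum.inr_injective hcol
      obtain ⟨h1, h2⟩ := side co hinj q b (!s) B A D hs.symm DB cB (fun e he => ⟨hDB e he, b2 e he⟩)
        c x y z hx hz hy.symm hxD hyD hzD hxy hyz (fun e he => congrFun hcol ⟨e, he⟩)
      rw [colB x hx, colB y h1]
      congr 1
      funext e
      exact h2 e e.2
  · intro x hx y hy _ _
    rw [colA x hx, colB y hy]
    simp
  · rw [Fintype.card_sum, Fintype.card_fun, Fintype.card_fun, Fintype.card_fin, Fintype.card_coe,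
      Fintype.card_coe]
    exact Nat.add_le_add (Nat.pow_le_pow_right hq hcA) (Nat.pow_le_pow_right hq hcB)

lemma cut_chain {V : Type} [DecidableEq V] (co : Bool → V → ℕ)
    (hinj : ∀ b, Function.Injective (co b)) (k : ℕ) (b : Bool) (A B A' B' : Finset V)
    (hA : A' ⊆ A) (hB : B' ⊆ B) (hd : Disjoint A' B') (hT : Thick (co (!b)) A' B')
    (hno : ¬ HasChain co (k + 1) b A B) (e : V) (he : e ∈ cuts (co (!b)) A' B') :
    ¬ HasChain co k (!b) (A'.filter fun a => co (!b) a < co (!b) e)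
      (A'.filter fun a => co (!b) e < co (!b) a) ∧
    ¬ HasChain co k (!b) (A'.filter fun a => co (!b) e < co (!b) a)
      (A'.filter fun a => co (!b) a < co (!b) e) := by
  simp only [cuts, Finset.mem_filter] at he
  have heB := (mem_starts.1 he.1).1
  obtain ⟨y', hy', hlt, hn⟩ := hT e he.1 he.2
  rw [← not_or]
  intro h
  have hne : e ≠ y' := by rintro rfl; exact lt_irrefl _ hlt
  refine hno ⟨e, hB heB, y', hB hy', hne, _, _, (Finset.filter_subset _ _).trans hA,
    (Finset.filter_subset _ _).trans hA, ?_, ?_, h⟩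
  · intro x hx
    have := (Finset.mem_filter.1 hx).2
    omega
  · intro x hx
    obtain ⟨h1, h2⟩ := Finset.mem_filter.1 hx
    have h3 : co (!b) x ≠ co (!b) y' := fun h =>
      Finset.disjoint_left.1 hd h1 (hinj _ h ▸ hy')
    have := hn x (Or.inl h1)
    omega

lemma IsCol.enlarge {V κ : Type} [DecidableEq V] {co : Bool → V → ℕ} {A B A' B' D : Finset V}
    {col : V → κ} (h : IsCol co A' B' D col) :
    IsCol co A B ((A \ A') ∪ (B \ B') ∪ D) col := by
  have hA : ∀ x ∈ A, x ∉ (A \ A') ∪ (B \ B') ∪ D → x ∈ A' ∧ x ∉ D := by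
    intro x hx hn
    simp only [Finset.mem_union, Finset.mem_sdiff] at hn
    tauto
  have hB : ∀ x ∈ B, x ∉ (A \ A') ∪ (B \ B') ∪ D → x ∈ B' ∧ x ∉ D := by
    intro x hx hn
    simp only [Finset.mem_union, Finset.mem_sdiff] at hn
    tauto
  have hAB : ∀ x, (x ∈ A ∨ x ∈ B) → x ∉ (A \ A') ∪ (B \ B') ∪ D → (x ∈ A' ∨ x ∈ B') ∧ x ∉ D := by
    rintro x (hx | hx) hn
    · exact ⟨Or.inl (hA x hx hn).1, (hA x hx hn).2⟩
    · exact ⟨Or.inr (hB x hx hn).1, (hB x hx hn).2⟩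
  refine ⟨?_, ?_⟩
  · intro b x y z hx hy hz hx' hy' hz' h1 h2 h3
    have a := hAB x hx hx'
    have b' := hAB y hy hy'
    have c := hAB z hz hz'
    exact h.1 b x y z a.1 b'.1 c.1 a.2 b'.2 c.2 h1 h2 h3
  · intro x hx y hy hx' hy'
    have a := hA x hx hx'
    have b' := hB y hy hy'
    exact h.2 x a.1 y b'.1 a.2 b'.2

theorem proc (k : ℕ) : ∃ q r : ℕ, 0 < q ∧ ∀ (V : Type) [DecidableEq V] (co : Bool → V → ℕ),
    (∀ b, Function.Injective (co b)) → NoR co → ∀ (b s : Bool) (A B : Finset V),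
    Sep (co b) s A B → ¬ HasChain co k b A B → ¬ HasChain co k b B A → SepCol co q r A B := by
  induction k with
  | zero =>
    refine ⟨1, 0, by norm_num, ?_⟩
    intro V _ co _ _ b s A B _ h1 h2
    have hB : B = ∅ := Finset.not_nonempty_iff_eq_empty.1 h1
    have hA : A = ∅ := Finset.not_nonempty_iff_eq_empty.1 h2
    subst hA hB
    refine ⟨∅, by simp, fun _ => 0, ?_, ?_⟩
    · intros; rfl
    · intro x hx; simp at hx
  | succ k ih =>
    obtain ⟨q, r, hq, H⟩ := ih
    refine ⟨q ^ 512 + q ^ 512, 512 + (512 * r + 512 * r), by positivity, ?_⟩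
    intro V _ co hinj hN b s A B hs h1 h2
    have n1 := no_alt co hinj hN b s A B hs
    have n2 := no_alt co hinj hN b (!s) B A hs.symm
    obtain ⟨A', hA', B', hB', e1, e2, e3, e4⟩ := thicken (co (!b)) (hinj _) 512 A B hs.disj (by omega)
    have hs' := hs.mono hA' hB'
    have cc : ∀ X Y, (cuts (co (!b)) X Y).card ≤ (starts (co (!b)) X Y).card := fun X Y =>
      Finset.card_le_card (Finset.filter_subset _ _)
    have c1 := cc A' B'
    have c2 := cc B' A'
    have sepc : ∀ (X : Finset V) (e : V), Sep (co (!b)) true (X.filter fun a => co (!b) a < co (!b) e)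
      (X.filter fun a => co (!b) e < co (!b) a) := by
      intro X e x hx y hy
      have := (Finset.mem_filter.1 hx).2
      have := (Finset.mem_filter.1 hy).2
      exact ⟨fun _ => by omega, by simp⟩
    obtain ⟨D, hD, col, hcol⟩ := combine co hinj q r 512 hq b s A' B' hs' (by
        intro e he
        obtain ⟨t1, t2⟩ := cut_chain co hinj k b A B A' B' hA' hB' hs'.disj e3 h1 e he
        exact H V co hinj hN (!b) true _ _ (sepc _ _) t1 t2) (by
        intro e he
        obtain ⟨t1, t2⟩ := cut_chain co hinj k b B A B' A' hB' hA' hs'.disj.symm e4 h2 e he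
        exact H V co hinj hN (!b) true _ _ (sepc _ _) t1 t2) (by omega) (by omega)
    refine ⟨_, ?_, col, hcol.enlarge⟩
    have := Finset.card_union_le ((A \ A') ∪ (B \ B')) D
    have := Finset.card_union_le (A \ A') (B \ B')
    omega

theorem proc_all : ∃ q r : ℕ, ∀ (V : Type) [DecidableEq V] (co : Bool → V → ℕ),
    (∀ b, Function.Injective (co b)) → NoR co → ∀ (b s : Bool) (A B : Finset V),
    Sep (co b) s A B → SepCol co q r A B := by
  obtain ⟨q4, r4, -, h4⟩ := proc 4
  obtain ⟨q5, r5, -, h5⟩ := proc 5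
  refine ⟨max q4 q5, max r4 r5, ?_⟩
  intro V _ co hinj hN b s A B hs
  cases b
  · exact (h5 V co hinj hN false s A B hs (no_chain5 co hinj hN A B)
      (no_chain5 co hinj hN B A)).mono (le_max_right _ _) (le_max_right _ _)
  · exact (h4 V co hinj hN true s A B hs (no_chain4 co hinj hN s A B hs)
      (no_chain4 co hinj hN (!s) B A hs.symm)).mono (le_max_left _ _) (le_max_left _ _)

end CC

namespace CC

def comp (π : Permu) : Permu := ⟨π.1, π.2.trans Fin.revPerm⟩

lemma comp_comp (π : Permu) : comp (comp π) = π := by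
  obtain ⟨n, p⟩ := π
  refine Sigma.ext rfl (heq_of_eq ?_)
  apply Equiv.ext
  intro i
  exact Fin.rev_rev (p i)

lemma comp_val (π : Permu) (x : Fin π.1) : ((comp π).2 x : ℕ) = π.1 - 1 - (π.2 x : ℕ) := by
  have : (comp π).2 x = Fin.rev (π.2 x) := rfl
  rw [this, Fin.val_rev]
  omega

lemma comp_lt (π : Permu) (x y : Fin π.1) : (comp π).2 x < (comp π).2 y ↔ π.2 y < π.2 x := by
  change Fin.rev (π.2 x) < Fin.rev (π.2 y) ↔ _
  exact Fin.rev_lt_rev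

lemma comp_le {σ τ : Permu} (h : PLe σ τ) : PLe (comp σ) (comp τ) := by
  obtain ⟨f, hf, h⟩ := h
  refine ⟨f, hf, ?_⟩
  intro i j
  exact (comp_lt σ i j).trans ((h j i).trans (comp_lt τ (f i) (f j)).symm)

lemma comp_psum (σ ρ : Permu) : comp (psum σ ρ) = pskew (comp σ) (comp ρ) := by
  obtain ⟨m, p⟩ := σ
  obtain ⟨n, q⟩ := ρ
  refine Sigma.ext rfl (heq_of_eq ?_)
  apply Equiv.ext
  intro i
  apply Fin.ext
  change ((Fin.rev (permSum p q i) : Fin (m + n)) : ℕ) =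
    (permSkew (p.trans Fin.revPerm) (q.trans Fin.revPerm) i : ℕ)
  revert i
  refine Fin.addCases (fun i => ?_) (fun i => ?_)
  · have := (p i).2
    rw [Fin.val_rev, permSum_left]
    simp [permSkew]
    omega
  · have := (q i).2
    rw [Fin.val_rev, permSum_right]
    simp [permSkew]
    omega

lemma skew_sub (π : Permu) {σ : Permu} (h : σ ∈ sumClosure (SubCl (comp π))) :
    comp σ ∈ skewClosure (SubCl π) := by
  have := Set.mem_sInter.1 h {σ | comp σ ∈ skewClosure (SubCl π)}
  apply this
  refine ⟨?_, ?_, ?_⟩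
  · intro a b hab hb
    refine Set.mem_sInter.2 fun D hD => ?_
    exact hD.1 _ _ (comp_le hab) (Set.mem_sInter.1 hb D hD)
  · intro a b ha hb
    change comp (psum a b) ∈ skewClosure (SubCl π)
    rw [comp_psum]
    refine Set.mem_sInter.2 fun D hD => ?_
    exact hD.2.1 _ _ (Set.mem_sInter.1 ha D hD) (Set.mem_sInter.1 hb D hD)
  · intro a ha
    refine Set.mem_sInter.2 fun D hD => hD.2.2 ?_
    have := comp_le (show PLe a (comp π) from ha)
    rw [comp_comp] at this
    exact this

lemma comp_good (π : Permu) (ξ : EReal) (h : ugr (skewClosure (SubCl π)) < ξ) :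
    ugr (sumClosure (SubCl (comp π))) < ξ := by
  refine lt_of_le_of_lt ?_ h
  have hc : ∀ n, pcount (sumClosure (SubCl (comp π))) n ≤ pcount (skewClosure (SubCl π)) n := by
    intro n
    refine Set.ncard_le_ncard_of_injOn comp ?_ ?_ (fin_cl _ _)
    · intro σ hσ
      exact ⟨skew_sub π hσ.1, hσ.2⟩
    · intro a _ b _ hab
      rw [← comp_comp a, hab, comp_comp]
  unfold ugr
  refine limsup_le_limsup (Eventually.of_forall fun n => ?_)
  have : ((pcount (sumClosure (SubCl (comp π))) n : ℝ) ^ ((n : ℝ)⁻¹)) ≤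
      ((pcount (skewClosure (SubCl π)) n : ℝ) ^ ((n : ℝ)⁻¹)) :=
    Real.rpow_le_rpow (by positivity) (by exact_mod_cast hc n) (by positivity)
  exact EReal.coe_le_coe_iff.2 this

lemma comp_co (π : Permu) (x y : Fin π.1) :
    pco (comp π) false x < pco (comp π) false y ↔ pco π false y < pco π false x := by
  have := comp_lt π x y
  simpa [pco] using this

lemma sep_comp (π : Permu) (b s : Bool) (A B : Finset (Fin π.1)) (h : Sep (pco π b) s A B) :
    ∃ s', Sep (V := Fin π.1) (pco (comp π) b) s' A B := by
  cases b
  · refine ⟨!s, ?_⟩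
    intro x hx y hy
    have := h x hx y hy
    cases s
    · exact ⟨fun _ => (comp_co π x y).2 (this.2 rfl), by simp⟩
    · exact ⟨by simp, fun _ => (comp_co π y x).2 (this.1 rfl)⟩
  · exact ⟨s, h⟩

lemma sepCol_comp (π : Permu) (q r : ℕ) (A B : Finset (Fin π.1))
    (h : SepCol (V := Fin π.1) (pco (comp π)) q r A B) : SepCol (pco π) q r A B := by
  obtain ⟨D, hD, col, hc⟩ := h
  refine ⟨D, hD, col, ?_, hc.2⟩
  intro b x y z hx hy hz hx' hy' hz' h1 h2 h3
  cases b
  · rw [hc.1 false z y x hz hy hx hz' hy' hx' ((comp_co π z y).2 h2) ((comp_co π y x).2 h1) h3.symm, h3]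
  · exact hc.1 true x y z hx hy hz hx' hy' hz' h1 h2 h3

lemma disj_int {V : Type} {ι : Type} (f : V → ℕ) (hf : Function.Injective f) (D : Finset V)
    (col : V → ι)
    (hc : ∀ x y z, x ∉ D → y ∉ D → z ∉ D → f x < f y → f y < f z → col x = col z → col y = col x)
    (i j : ι) (hij : i ≠ j) (x0 x1 y0 y1 : V) (hx0 : x0 ∉ D ∧ col x0 = i) (hx1 : x1 ∉ D ∧ col x1 = i)
    (hy0 : y0 ∉ D ∧ col y0 = j) (hy1 : y1 ∉ D ∧ col y1 = j) :
    f x1 + 1 < f y0 + 1 ∨ f y1 + 1 < f x0 + 1 := by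
  have ne : ∀ x y, col x = i → col y = j → f x ≠ f y := by
    intro x y h1 h2 h
    rw [hf h] at h1
    exact hij (h1.symm.trans h2)
  have n1 := ne x1 y0 hx1.2 hy0.2
  have n2 := ne x0 y1 hx0.2 hy1.2
  have n3 := ne x0 y0 hx0.2 hy0.2
  by_contra hcon
  rcases lt_or_gt_of_ne n3 with h | h
  · have := hc x0 y0 x1 hx0.1 hy0.1 hx1.1 h (by omega) (hx0.2.trans hx1.2.symm)
    exact hij (hx0.2.symm.trans (this.symm.trans hy0.2))
  · have := hc y0 x0 y1 hy0.1 hx0.1 hy1.1 h (by omega) (hy0.2.trans hy1.2.symm)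
    exact hij (hx0.2.symm.trans (this.trans hy0.2))

lemma conc_of (π : Permu) (q r : ℕ)
    (h : ∀ (b s : Bool) (A B : Finset (Fin π.1)), Sep (pco π b) s A B → SepCol (pco π) q r A B) :
    ConcentratedQR q r π := by
  classical
  intro vert c _
  let A : Finset (Fin π.1) := Finset.univ.filter fun x => pco π vert x < c
  let B : Finset (Fin π.1) := Finset.univ.filter fun x => c ≤ pco π vert x
  have hsep : Sep (pco π vert) true A B := by
    intro x hx y hy
    have h1 := (Finset.mem_filter.1 hx).2
    have h2 := (Finset.mem_filter.1 hy).2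
    exact ⟨fun _ => by omega, by simp⟩
  obtain ⟨D, hD, col, hc1, hc2⟩ := h vert true A B hsep
  have hall : ∀ x, x ∈ A ∨ x ∈ B := by
    intro x
    simp only [A, B, Finset.mem_filter, Finset.mem_univ, true_and]
    omega
  have hc3 : ∀ b x y z, x ∉ D → y ∉ D → z ∉ D → pco π b x < pco π b y → pco π b y < pco π b z →
      col x = col z → col y = col x := fun b x y z =>
    hc1 b x y z (hall x) (hall y) (hall z)
  let X : Fin q → Finset (Fin π.1) := fun i => Finset.univ.filter fun x => x ∉ D ∧ col x = i
  have hX : ∀ i x, x ∈ X i ↔ x ∉ D ∧ col x = i := by intro i x; simp [X]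
  have hull : ∀ i, ∃ R : Rect, (X i).Nonempty → (∃ x ∈ X i, R.a = pco π true x + 1) ∧
      (∃ x ∈ X i, R.b = pco π true x + 1) ∧ (∃ x ∈ X i, R.c = pco π false x + 1) ∧
      (∃ x ∈ X i, R.d = pco π false x + 1) ∧ ∀ x ∈ X i, rectCovers R π x := by
    intro i
    by_cases hne : (X i).Nonempty
    · obtain ⟨xa, ha, ha'⟩ := Finset.exists_min_image (X i) (pco π true) hne
      obtain ⟨xb, hb, hb'⟩ := Finset.exists_max_image (X i) (pco π true) hne
      obtain ⟨xc, hc, hc'⟩ := Finset.exists_min_image (X i) (pco π false) hne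
      obtain ⟨xd, hd, hd'⟩ := Finset.exists_max_image (X i) (pco π false) hne
      refine ⟨⟨pco π true xa + 1, pco π true xb + 1, pco π false xc + 1, pco π false xd + 1⟩,
        fun _ => ⟨⟨xa, ha, rfl⟩, ⟨xb, hb, rfl⟩, ⟨xc, hc, rfl⟩, ⟨xd, hd, rfl⟩, ?_⟩⟩
      intro x hx
      have e1 := ha' x hx
      have e2 := hb' x hx
      have e3 := hc' x hx
      have e4 := hd' x hx
      have t1 : pco π true x = (x : ℕ) := rfl
      have t2 : pco π false x = (π.2 x : ℕ) := rfl
      rw [t1] at e1 e2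
      rw [t2] at e3 e4
      exact ⟨Nat.succ_le_succ e1, Nat.succ_le_succ e2, Nat.succ_le_succ e3, Nat.succ_le_succ e4⟩
    · exact ⟨⟨0, 0, 0, 0⟩, fun h => (hne h).elim⟩
  choose R hR using hull
  have hside : ∀ i, ∀ x ∈ X i, ∀ y ∈ X i, pco π vert x < c → pco π vert y < c := by
    intro i x hx y hy hxc
    by_contra hyc
    have hx' := (hX i x).1 hx
    have hy' := (hX i y).1 hy
    refine hc2 x ?_ y ?_ hx'.1 hy'.1 (hx'.2.trans hy'.2.symm)
    · simpa [A] using hxc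
    · simpa [B] using hyc
  refine ⟨(Finset.univ.filter fun i => (X i).Nonempty).image R, ?_, ?_, ?_, ?_⟩
  · refine Finset.card_image_le.trans ((Finset.card_filter_le _ _).trans ?_)
    simp
  · intro S hS
    obtain ⟨i, hi, rfl⟩ := Finset.mem_image.1 hS
    obtain ⟨⟨xa, ha, ha'⟩, ⟨xb, hb, hb'⟩, ⟨xc, hc, hc'⟩, ⟨xd, hd, hd'⟩, -⟩ :=
      hR i (Finset.mem_filter.1 hi).2
    unfold rectAvoids
    cases vert
    · have := hside i xc hc xd hd
      simp only [Bool.false_eq_true, if_false]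
      rw [hc', hd']
      omega
    · have := hside i xa ha xb hb
      simp only [if_true]
      rw [ha', hb']
      omega
  · intro S hS T hT hne
    obtain ⟨i, hi, rfl⟩ := Finset.mem_image.1 hS
    obtain ⟨j, hj, rfl⟩ := Finset.mem_image.1 hT
    have hij : i ≠ j := fun h => hne (by rw [h])
    obtain ⟨⟨xa, ha, ha'⟩, ⟨xb, hb, hb'⟩, ⟨xc, hc, hc'⟩, ⟨xd, hd, hd'⟩, -⟩ :=
      hR i (Finset.mem_filter.1 hi).2
    obtain ⟨⟨ya, ka, ka'⟩, ⟨yb, kb, kb'⟩, ⟨yc, kc, kc'⟩, ⟨yd, kd, kd'⟩, -⟩ :=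
      hR j (Finset.mem_filter.1 hj).2
    refine ⟨?_, ?_⟩
    · rw [ha', hb', ka', kb']
      exact disj_int (pco π true) (pco_inj π true) D col (hc3 true) i j hij xa xb ya yb
        ((hX _ _).1 ha) ((hX _ _).1 hb) ((hX _ _).1 ka) ((hX _ _).1 kb)
    · rw [hc', hd', kc', kd']
      exact disj_int (pco π false) (pco_inj π false) D col (hc3 false) i j hij xc xd yc yd
        ((hX _ _).1 hc) ((hX _ _).1 hd) ((hX _ _).1 kc) ((hX _ _).1 kd)
  · refine le_trans ?_ hD
    rw [← Set.ncard_coe_finset]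
    refine Set.ncard_le_ncard ?_ (Finset.finite_toSet _)
    intro x hx
    by_contra hxD
    have hxX : x ∈ X (col x) := (hX _ _).2 ⟨hxD, rfl⟩
    exact hx ⟨R (col x), Finset.mem_image.2 ⟨col x, by simpa using ⟨x, hxX⟩, rfl⟩,
      (hR _ ⟨x, hxX⟩).2.2.2.2 x hxX⟩

end CC

/-- The cell class `G_ξ` is concentrated: there exist `q` and `r` such
that every permutation in `G_ξ` is `(q,r)`-concentrated. -/
theorem cellClass_xi_concentrated
    (ξ : ℝ) (hpos : 0 < ξ) (hroot : ξ ^ 5 - 2 * ξ ^ 4 - ξ ^ 2 - ξ - 1 = 0) :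
    ∃ q r : ℕ, ∀ π ∈ cellClass ξ, ConcentratedQR q r π := by
  obtain ⟨q, r, H⟩ := CC.proc_all
  refine ⟨q, r, fun π hπ => CC.conc_of π q r fun b s A B hs => ?_⟩
  rcases hπ with h | h
  · exact H _ (CC.pco π) (CC.pco_inj π) (CC.no_realz π ξ hpos hroot h) b s A B hs
  · obtain ⟨s', hs'⟩ := CC.sep_comp π b s A B hs
    exact CC.sepCol_comp π q r A B (H _ (CC.pco (CC.comp π)) (CC.pco_inj _)
      (CC.no_realz _ ξ hpos hroot (CC.comp_good π _ h)) b s' A B hs')
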